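/- Let F = ℚ(√d) with d ≥ 6 squarefree and let H be a totally definite quaternion F-algebra. Then t(H, A₄) = 1 if H is F-isomorphic to (−1,−1/F) and 2ε ∉ F^{×2}, and t(H, A₄) = 0 otherwise. (Here A₄ is the alternating group on 4 letters.) -/

import Mathlib

open NumberField Quaternion

noncomputable section

namespace QuatPaper

variable (F : Type) [Field F] [NumberField F]

def scalarSet (H : Type) [Ring H] [Algebra F H] : Set H :=
  Set.range fun r : 𝓞 F => algebraMap F H (algebraMap (𝓞 F) F r)

def IsOrder {H : Type} [Ring H] [Algebra F H] (O : Subring H) : Prop :=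
  scalarSet F H ⊆ ↑O ∧ O.toAddSubgroup.FG ∧ Submodule.span F (O : Set H) = ⊤

def IsMaximalOrder {H : Type} [Ring H] [Algebra F H] (O : Subring H) : Prop :=
  IsOrder F O ∧ ∀ O' : Subring H, IsOrder F O' → O ≤ O' → O' = O

def IsScalarUnit {H : Type} [Ring H] [Algebra F H] {O : Subring H} (u : (↥O)ˣ) : Prop :=
  ∃ r : (𝓞 F)ˣ, ((u : ↥O) : H) = algebraMap F H (algebraMap (𝓞 F) F ↑r)

def RedUnitIso {H : Type} [Ring H] [Algebra F H] (O : Subring H) (G : Type*) [Group G] : Prop :=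
  ∃ φ : (↥O)ˣ →* G, Function.Surjective φ ∧ ∀ u, φ u = 1 ↔ IsScalarUnit F u

def IsConjugate {H : Type} [Ring H] (x : Hˣ) (O O' : Subring H) : Prop :=
  ∀ y : H, y ∈ O ↔ (x : H) * y * ((x⁻¹ : Hˣ) : H) ∈ O'

def ConjRel {H : Type} [Ring H] (O O' : Subring H) : Prop :=
  ∃ x : Hˣ, IsConjugate x O O'

def typeNum (H : Type) [Ring H] [Algebra F H] (G : Type*) [Group G] : ℕ :=
  Nat.card (Quot fun O O' : {O : Subring H // IsMaximalOrder F O ∧ RedUnitIso F O G} =>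
    ConjRel O.1 O'.1)

def IsQuatAlg (H : Type) [Ring H] [Algebra F H] : Prop :=
  ∃ a b : F, a ≠ 0 ∧ b ≠ 0 ∧ Nonempty (H ≃ₐ[F] ℍ[F, a, b])

def TotallyDefinite (H : Type) [Ring H] [Algebra F H] : Prop :=
  ∀ σ : F →+* ℝ,
    letI : Algebra F ℝ := σ.toAlgebra
    ∀ x : TensorProduct F ℝ H, x ≠ 0 → IsUnit x

section Congruences

open Polynomial in
/-- If an integral element over an integrally closed domain is a non-scalar root of a monic
quadratic polynomial over the fraction field, then the coefficients are integral. -/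
theorem exists_algebraMap_eq_of_quadratic {R K A : Type*} [CommRing R] [IsDomain R]
    [IsIntegrallyClosed R] [Field K] [Algebra R K] [IsFractionRing R K] [Ring A] [Nontrivial A]
    [Algebra K A] {x : A} (hx : IsIntegral ℤ x) {t n : K}
    (h : x * x - t • x + algebraMap K A n = 0) (hs : ∀ r : K, algebraMap K A r ≠ x) :
    (∃ r : R, algebraMap R K r = t) ∧ ∃ r : R, algebraMap R K r = n := by
  obtain ⟨f, hf, hfx⟩ := hx
  set g : K[X] := X ^ 2 - C t * X + C n with hg
  have hgd : g.natDegree = 2 := by rw [hg]; compute_degree!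
  have hgm : g.Monic := by rw [hg]; monicity!
  have hgx : aeval x g = 0 := by
    rw [hg]; simp only [map_add, map_sub, map_mul, map_pow, aeval_X, aeval_C]
    rw [← h, Algebra.smul_def, sq]
  have hFx : aeval x (f.map (algebraMap ℤ K)) = 0 := by
    rw [aeval_map_algebraMap]; exact hfx
  have hdvd : g ∣ f.map (algebraMap ℤ K) := by
    rw [← Polynomial.modByMonic_eq_zero_iff_dvd hgm]
    set q := f.map (algebraMap ℤ K) %ₘ g with hq
    have hqx : aeval x q = 0 := by
      rw [hq, Polynomial.modByMonic_eq_sub_mul_div, map_sub, map_mul, hFx, hgx]; simp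
    have hqd : q.natDegree ≤ 1 := by
      have : q.natDegree < g.natDegree := natDegree_modByMonic_lt (f.map (algebraMap ℤ K)) hgm
        (by intro h1; rw [h1] at hgd; simp at hgd)
      rw [hgd] at this; omega
    have hqe := Polynomial.eq_X_add_C_of_natDegree_le_one hqd
    rw [hqe] at hqx
    simp only [map_add, map_mul, aeval_X, aeval_C] at hqx
    have h1 : q.coeff 1 = 0 := by
      by_contra h1
      apply hs (-(q.coeff 1)⁻¹ * q.coeff 0)
      have : algebraMap K A (q.coeff 0) = -(algebraMap K A (q.coeff 1) * x) := by
        rw [eq_neg_iff_add_eq_zero, add_comm]; exact hqx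
      rw [map_mul, this, map_neg, neg_mul_neg, ← mul_assoc, ← map_mul, inv_mul_cancel₀ h1]
      simp
    rw [h1] at hqx
    have h0 : q.coeff 0 = 0 := by
      apply (algebraMap K A).injective; simpa using hqx
    rw [hqe, h1, h0]; simp
  have hfm : f.map (algebraMap ℤ K) = (f.map (algebraMap ℤ R)).map (algebraMap R K) := by
    rw [Polynomial.map_map]; congr 1; exact RingHom.ext_int _ _
  rw [hfm] at hdvd
  obtain ⟨g', hg'⟩ := IsIntegrallyClosed.eq_map_mul_C_of_dvd K (hf.map (algebraMap ℤ R)) hdvd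
  rw [hgm.leadingCoeff, C_1, mul_one] at hg'
  refine ⟨⟨-g'.coeff 1, ?_⟩, g'.coeff 0, ?_⟩
  · rw [map_neg, ← coeff_map, hg', hg]; simp [coeff_C]
  · rw [← coeff_map, hg', hg]; simp

/-- A rational number whose square times a squarefree integer is an integer is an integer. -/
theorem exists_int_of_squarefree_mul_sq {d : ℕ} (hd : Squarefree d) {q : ℚ} {N : ℤ}
    (h : (d : ℚ) * q ^ 2 = N) : ∃ n : ℤ, (n : ℚ) = q := by
  have h1 : (d : ℤ) * q.num ^ 2 = N * (q.den : ℤ) ^ 2 := by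
    have hq : (q.den : ℚ) ≠ 0 := by exact_mod_cast q.den_nz
    have : (d : ℚ) * (q.num : ℚ) ^ 2 = N * (q.den : ℚ) ^ 2 := by
      rw [← h]; nth_rewrite 2 [← Rat.num_div_den q]; field_simp
    exact_mod_cast this
  have h2 : (q.den : ℤ) ^ 2 ∣ (d : ℤ) := by
    have hc : IsCoprime ((q.den : ℤ) ^ 2) (q.num ^ 2) := by
      apply IsCoprime.pow
      rw [Int.isCoprime_iff_gcd_eq_one]
      have := q.reduced
      rw [Int.gcd, Int.natAbs_natCast]; exact this.symm
    exact hc.dvd_of_dvd_mul_right ⟨N, by rw [h1]; ring⟩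
  have h3 : q.den ^ 2 ∣ d := by exact_mod_cast h2
  have h4 : q.den = 1 := by
    have := hd q.den (by rwa [← sq]); simpa using this
  exact ⟨q.num, by rw [← Rat.num_div_den q, h4]; simp⟩

variable {F : Type} [Field F] [NumberField F]

theorem exists_rat_coords {s : F} {d : ℕ} (hs : s ^ 2 = (d : F))
    (hgen : Algebra.adjoin ℚ {s} = ⊤) (x : F) : ∃ a b : ℚ, x = a + b * s := by
  have hx : x ∈ Algebra.adjoin ℚ {s} := by rw [hgen]; trivial
  induction hx using Algebra.adjoin_induction with
  | mem x hx => exact ⟨0, 1, by rw [Set.mem_singleton_iff.1 hx]; simp⟩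
  | algebraMap r => exact ⟨r, 0, by simp⟩
  | add x y _ _ hx hy =>
    obtain ⟨a, b, rfl⟩ := hx
    obtain ⟨a', b', rfl⟩ := hy
    exact ⟨a + a', b + b', by push_cast; ring⟩
  | mul x y _ _ hx hy =>
    obtain ⟨a, b, rfl⟩ := hx
    obtain ⟨a', b', rfl⟩ := hy
    exact ⟨a * a' + d * b * b', a * b' + a' * b, by push_cast; linear_combination (b * b' : F) * hs⟩

theorem sq_ne_of_squarefree {d : ℕ} (hd : Squarefree d) (h2 : 2 ≤ d) (q : ℚ) : q ^ 2 ≠ d := by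
  intro h
  obtain ⟨n, rfl⟩ := exists_int_of_squarefree_mul_sq squarefree_one (q := q) (N := d)
    (by push_cast; rw [h]; simp)
  have h3 : n.natAbs ^ 2 = d := by
    zify; rw [sq_abs]; exact_mod_cast h
  have := hd n.natAbs ⟨1, by rw [← h3]; ring⟩
  rw [Nat.isUnit_iff] at this
  rw [this] at h3; omega

theorem int_coords_eq_zero {s : F} {d : ℕ} (hd : Squarefree d) (h2 : 2 ≤ d) (hs : s ^ 2 = (d : F))
    {a b : ℤ} (h : (a : F) + b * s = 0) : a = 0 ∧ b = 0 := by
  have hb : b = 0 := by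
    by_contra hb
    have hb' : (b : F) ≠ 0 := by exact_mod_cast hb
    have hs' : s = ((-a / b : ℚ) : F) := by
      push_cast; field_simp; linear_combination h
    rw [hs'] at hs
    exact sq_ne_of_squarefree hd h2 _ (by exact_mod_cast hs)
  subst hb
  simpa using h

/-- Shape of the integers of a real quadratic field. -/
theorem exists_half_coords {s : F} {d : ℕ} (hd : Squarefree d) (h2 : 2 ≤ d) (hs : s ^ 2 = (d : F))
    (hgen : Algebra.adjoin ℚ {s} = ⊤) (x : 𝓞 F) :
    ∃ m n : ℤ, 2 * algebraMap (𝓞 F) F x = m + n * s ∧ (2 : ℤ) ∣ m - n ∧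
      (d % 4 ≠ 1 → (2 : ℤ) ∣ n) := by
  obtain ⟨a, b, hab⟩ := exists_rat_coords hs hgen (algebraMap (𝓞 F) F x)
  have hint : IsIntegral ℤ (algebraMap (𝓞 F) F x) := x.isIntegral_coe
  have key : (∃ t : ℤ, (t : ℚ) = 2 * a) ∧ ∃ N : ℤ, (N : ℚ) = a ^ 2 - d * b ^ 2 := by
    by_cases hb : ∀ r : ℚ, algebraMap ℚ F r ≠ algebraMap (𝓞 F) F x
    · refine exists_algebraMap_eq_of_quadratic (R := ℤ) hint ?_ hb
      rw [hab, Algebra.smul_def]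
      simp
      linear_combination (b : F) ^ 2 * hs
    · push Not at hb
      obtain ⟨r, hr⟩ := hb
      have hr' : IsIntegral ℤ r := by
        rw [← hr] at hint
        exact (isIntegral_algebraMap_iff (algebraMap ℚ F).injective).1 hint
      obtain ⟨k, hk⟩ := IsIntegrallyClosed.isIntegral_iff.1 hr'
      have hb0 : b = 0 := by
        by_contra hb0
        have hb' : (b : F) ≠ 0 := by exact_mod_cast hb0
        have hs' : s = (((r - a) / b : ℚ) : F) := by
          have : (r : F) = a + b * s := by rw [← hab, ← hr]; simp
          push_cast; field_simp; linear_combination -this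
        rw [hs'] at hs
        exact sq_ne_of_squarefree hd h2 _ (by exact_mod_cast hs)
      have ha : a = r := by
        have : (r : F) = a + b * s := by rw [← hab, ← hr]; simp
        rw [hb0] at this
        simp at this; exact this.symm
      have hk' : (k : ℚ) = r := by simpa using hk
      refine ⟨⟨2 * k, ?_⟩, k ^ 2, ?_⟩
      · push_cast; rw [hk', ha]
      · push_cast; rw [hk', ha, hb0]; simp
  obtain ⟨⟨m, hm⟩, N, hN⟩ := key
  obtain ⟨n, hn⟩ := exists_int_of_squarefree_mul_sq hd (q := 2 * b) (N := m ^ 2 - 4 * N)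
    (by push_cast; rw [hm, hN]; ring)
  have hrel : (m : ℤ) ^ 2 - d * n ^ 2 = 4 * N := by
    have : (m : ℚ) ^ 2 - d * n ^ 2 = 4 * N := by rw [hm, hn, hN]; ring
    exact_mod_cast this
  have hm' : (m : F) = 2 * a := by exact_mod_cast congrArg (Rat.cast (K := F)) hm
  have hn' : (n : F) = 2 * b := by exact_mod_cast congrArg (Rat.cast (K := F)) hn
  have h4 : ¬ 4 ∣ d := fun h => by
    have := hd 2 (by simpa using h); simp at this
  have hpar : (2 : ℤ) ∣ m - n ∧ (d % 4 ≠ 1 → (2 : ℤ) ∣ n) := by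
    obtain ⟨e, r, hr, hde⟩ : ∃ e r : ℤ, (r = 1 ∨ r = 2 ∨ r = 3) ∧ (d : ℤ) = 4 * e + r := by
      refine ⟨d / 4, d % 4, ?_, ?_⟩ <;> omega
    have hr1 : d % 4 ≠ 1 → r ≠ 1 := by omega
    rw [hde] at hrel
    rcases Int.even_or_odd' m with ⟨u, rfl | rfl⟩ <;> rcases Int.even_or_odd' n with ⟨v, rfl | rfl⟩
    · constructor <;> intros <;> omega
    · exfalso
      rcases hr with rfl | rfl | rfl <;> ring_nf at hrel <;> omega
    · exfalso
      rcases hr with rfl | rfl | rfl <;> ring_nf at hrel <;> omega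
    · refine ⟨by omega, fun h => ?_⟩
      have := hr1 h
      rcases hr with rfl | rfl | rfl
      · omega
      all_goals exfalso; ring_nf at hrel; omega
  exact ⟨m, n, by rw [hm', hn', hab]; ring, hpar⟩

end Congruences

section QuadraticField

variable {F : Type} [Field F] [NumberField F]

omit [NumberField F] in
theorem exists_coe_eq_of_isIntegral {x : F} (hx : IsIntegral ℤ x) :
    ∃ r : 𝓞 F, algebraMap (𝓞 F) F r = x :=
  ⟨⟨x, hx⟩, rfl⟩

theorem exists_quadratic_generator {s : F} {d : ℕ} (hd : Squarefree d) (h2 : 2 ≤ d)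
    (hs : s ^ 2 = (d : F)) (hgen : Algebra.adjoin ℚ {s} = ⊤) :
    ∃ θ : 𝓞 F, (∀ x : 𝓞 F, ∃ m n : ℤ, x = m + n * θ) ∧
      (∀ m n : ℤ, (2 : 𝓞 F) ∣ m + n * θ → (2 : ℤ) ∣ m ∧ (2 : ℤ) ∣ n) ∧
      ((∃ k : ℤ, θ ^ 2 = θ + k) ∨ (2 : 𝓞 F) ∣ θ ^ 2) := by
  have hsint : IsIntegral ℤ s := by
    apply IsIntegral.of_pow (n := 2) (by norm_num)
    rw [hs]; simpa using isIntegral_algebraMap (R := ℤ) (A := F) (x := (d : ℤ))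
  have finish : ∀ θ : 𝓞 F, (∀ x : 𝓞 F, ∃ m n : ℤ, x = m + n * θ) →
      (∀ m n : ℤ, (m + n * algebraMap (𝓞 F) F θ : F) = 0 → m = 0 ∧ n = 0) →
      ∀ m n : ℤ, (2 : 𝓞 F) ∣ m + n * θ → (2 : ℤ) ∣ m ∧ (2 : ℤ) ∣ n := by
    rintro θ h1 h2 m n ⟨y, hy⟩
    obtain ⟨m', n', rfl⟩ := h1 y
    have hy' := congrArg (algebraMap (𝓞 F) F) hy
    have := h2 (m - 2 * m') (n - 2 * n') (by
      simp only [map_add, map_mul, map_intCast, map_ofNat] at hy'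
      push_cast; linear_combination hy')
    omega
  have h4 : ¬ 4 ∣ d := fun h => by
    have := hd 2 (by simpa using h); simp at this
  by_cases hd1 : d % 4 = 1
  · obtain ⟨k, hk⟩ : ∃ k : ℕ, d = 4 * k + 1 := ⟨d / 4, by omega⟩
    have hkF : (d : F) = 4 * k + 1 := by rw [hk]; push_cast; ring
    have hrel : ((1 + s) / 2) ^ 2 - (1 + s) / 2 = (k : F) := by
      rw [hkF] at hs; linear_combination hs / 4
    have hθ : IsIntegral ℤ ((1 + s) / 2) := by
      refine ⟨Polynomial.X ^ 2 - Polynomial.X - Polynomial.C (k : ℤ), by monicity!, ?_⟩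
      simp only [Polynomial.eval₂_sub, Polynomial.eval₂_X_pow, Polynomial.eval₂_X,
        Polynomial.eval₂_C]
      rw [hrel]; simp
    obtain ⟨θ, hθ⟩ := exists_coe_eq_of_isIntegral hθ
    have hbasis : ∀ x : 𝓞 F, ∃ m n : ℤ, x = m + n * θ := by
      intro x
      obtain ⟨m, n, h, ⟨e, he⟩, -⟩ := exists_half_coords hd h2 hs hgen x
      refine ⟨e, n, ?_⟩
      apply RingOfIntegers.coe_injective
      have he' : (m : F) = n + 2 * e := by
        have : m = n + 2 * e := by omega
        rw [this]; push_cast; ring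
      simp only [map_add, map_mul, map_intCast, hθ]
      linear_combination h / 2 + he' / 2
    refine ⟨θ, hbasis, finish _ hbasis ?_, Or.inl ⟨k, ?_⟩⟩
    · intro m n h
      have := int_coords_eq_zero hd h2 hs (a := 2 * m + n) (b := n) (by
        rw [hθ] at h
        push_cast; linear_combination 2 * h)
      omega
    · apply RingOfIntegers.coe_injective
      simp only [map_add, map_pow, map_intCast, hθ]
      push_cast; linear_combination hrel
  · obtain ⟨e, k, hk⟩ : ∃ e k : ℕ, d + e ^ 2 = 2 * k ∧ True := by
      rcases Nat.even_or_odd' d with ⟨k, rfl | rfl⟩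
      · exact ⟨0, k, by simp⟩
      · exact ⟨1, k + 1, by ring, trivial⟩
    have hkF : (d : F) + e ^ 2 = 2 * k := by exact_mod_cast congrArg (Nat.cast (R := F)) hk.1
    have hθ : IsIntegral ℤ (s + e) := hsint.add 
      (by simpa using isIntegral_algebraMap (R := ℤ) (A := F) (x := (e : ℤ)))
    obtain ⟨θ, hθ⟩ := exists_coe_eq_of_isIntegral hθ
    obtain ⟨s', hs'⟩ := exists_coe_eq_of_isIntegral hsint
    have hbasis : ∀ x : 𝓞 F, ∃ m n : ℤ, x = m + n * θ := by
      intro x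
      obtain ⟨m, n, h, hmn, hn⟩ := exists_half_coords hd h2 hs hgen x
      obtain ⟨n', rfl⟩ := hn hd1
      obtain ⟨m', rfl⟩ : (2 : ℤ) ∣ m := by omega
      refine ⟨m' - n' * e, n', ?_⟩
      apply RingOfIntegers.coe_injective
      simp only [map_add, map_mul, map_intCast, hθ]
      push_cast at h ⊢
      linear_combination h / 2
    refine ⟨θ, hbasis, finish _ hbasis ?_, Or.inr ⟨k + e * s', ?_⟩⟩
    · intro m n h
      have := int_coords_eq_zero hd h2 hs (a := m + n * e) (b := n) (by
        rw [hθ] at h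
        push_cast; linear_combination h)
      obtain ⟨h1, rfl⟩ := this
      simpa using h1
    · apply RingOfIntegers.coe_injective
      simp only [map_add, map_mul, map_pow, map_natCast, map_ofNat, hθ, hs']
      linear_combination hs + hkF

/-- If three squares of integers sum up to `4`, the integers are rational. -/
theorem exists_int_of_sum_sq_eq_four {s : F} {d : ℕ} (hd : Squarefree d) (h6 : 6 ≤ d)
    (hs : s ^ 2 = (d : F)) (hgen : Algebra.adjoin ℚ {s} = ⊤) {x y z : 𝓞 F}
    (h : x ^ 2 + y ^ 2 + z ^ 2 = 4) : ∃ a b c : ℤ, x = a ∧ y = b ∧ z = c := by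
  have h2 : 2 ≤ d := by omega
  obtain ⟨m, n, hx, hmn, hn⟩ := exists_half_coords hd h2 hs hgen x
  obtain ⟨m', n', hy, hmn', hn'⟩ := exists_half_coords hd h2 hs hgen y
  obtain ⟨m'', n'', hz, hmn'', hn''⟩ := exists_half_coords hd h2 hs hgen z
  have hF : algebraMap (𝓞 F) F x ^ 2 + algebraMap (𝓞 F) F y ^ 2 + algebraMap (𝓞 F) F z ^ 2 = 4 := by
    simpa only [map_add, map_pow, map_ofNat] using congrArg (algebraMap (𝓞 F) F) h
  have key := (int_coords_eq_zero hd h2 hs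
    (a := m ^ 2 + m' ^ 2 + m'' ^ 2 + d * (n ^ 2 + n' ^ 2 + n'' ^ 2) - 16)
    (b := 2 * (m * n + m' * n' + m'' * n'')) (by
      push_cast
      linear_combination 4 * hF - (2 * algebraMap (𝓞 F) F x + m + n * s) * hx
        - (2 * algebraMap (𝓞 F) F y + m' + n' * s) * hy
        - (2 * algebraMap (𝓞 F) F z + m'' + n'' * s) * hz
        - ((n : F) ^ 2 + (n' : F) ^ 2 + (n'' : F) ^ 2) * hs)).1
  have hd6 : (6 : ℤ) ≤ d := by exact_mod_cast h6
  have hzero : n = 0 ∧ n' = 0 ∧ n'' = 0 := by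
    by_cases hd1 : d % 4 = 1
    · have hd9 : (9 : ℤ) ≤ d := by omega
      have hN : n ^ 2 + n' ^ 2 + n'' ^ 2 ≤ 1 := by
        nlinarith [sq_nonneg m, sq_nonneg m', sq_nonneg m'', sq_nonneg n, sq_nonneg n',
          sq_nonneg n'']
      have h1 : n ^ 2 = 0 ∨ n ^ 2 = 1 := by
        have := sq_nonneg n; have := sq_nonneg n'; have := sq_nonneg n''; omega
      have h1' : n' ^ 2 = 0 ∨ n' ^ 2 = 1 := by
        have := sq_nonneg n; have := sq_nonneg n'; have := sq_nonneg n''; omega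
      have h1'' : n'' ^ 2 = 0 ∨ n'' ^ 2 = 1 := by
        have := sq_nonneg n; have := sq_nonneg n'; have := sq_nonneg n''; omega
      have hmod : ∀ u v : ℤ, (2 : ℤ) ∣ u - v → (v ^ 2 = 0 ∨ v ^ 2 = 1) →
          ∃ k : ℤ, u ^ 2 = 4 * k + v ^ 2 := by
        rintro u v ⟨k, hk⟩ -
        exact ⟨k ^ 2 + k * v, by rw [show u = v + 2 * k by omega]; ring⟩
      obtain ⟨k, hk⟩ := hmod m n hmn h1
      obtain ⟨k', hk'⟩ := hmod m' n' hmn' h1'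
      obtain ⟨k'', hk''⟩ := hmod m'' n'' hmn'' h1''
      have hsum : n ^ 2 + n' ^ 2 + n'' ^ 2 = 0 := by
        by_contra hne
        have h1 : n ^ 2 + n' ^ 2 + n'' ^ 2 = 1 := by
          have := sq_nonneg n; have := sq_nonneg n'; have := sq_nonneg n''; omega
        rw [h1] at key
        omega
      have := sq_nonneg n; have := sq_nonneg n'; have := sq_nonneg n''
      refine ⟨?_, ?_, ?_⟩ <;> apply pow_eq_zero_iff (two_ne_zero) |>.1 <;> omega
    · obtain ⟨e, rfl⟩ := hn hd1
      obtain ⟨e', rfl⟩ := hn' hd1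
      obtain ⟨e'', rfl⟩ := hn'' hd1
      have hsum : e ^ 2 + e' ^ 2 + e'' ^ 2 < 1 := by
        nlinarith [sq_nonneg m, sq_nonneg m', sq_nonneg m'', sq_nonneg e, sq_nonneg e',
          sq_nonneg e'']
      have := sq_nonneg e; have := sq_nonneg e'; have := sq_nonneg e''
      have h0 : e ^ 2 = 0 := by omega
      have h0' : e' ^ 2 = 0 := by omega
      have h0'' : e'' ^ 2 = 0 := by omega
      simp only [pow_eq_zero_iff (two_ne_zero)] at h0 h0' h0''
      subst h0 h0' h0''; simp
  obtain ⟨rfl, rfl, rfl⟩ := hzero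
  obtain ⟨a, rfl⟩ : (2 : ℤ) ∣ m := by simpa using hmn
  obtain ⟨b, rfl⟩ : (2 : ℤ) ∣ m' := by simpa using hmn'
  obtain ⟨c, rfl⟩ : (2 : ℤ) ∣ m'' := by simpa using hmn''
  refine ⟨a, b, c, ?_, ?_, ?_⟩ <;> apply RingOfIntegers.coe_injective <;> push_cast at hx hy hz <;>
    simp only [map_intCast]
  · linear_combination hx / 2
  · linear_combination hy / 2
  · linear_combination hz / 2

theorem two_ne_sq {s : F} {d : ℕ} (hd : Squarefree d) (h6 : 6 ≤ d)
    (hs : s ^ 2 = (d : F)) (hgen : Algebra.adjoin ℚ {s} = ⊤) (x : F) : x ^ 2 ≠ 2 := by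
  intro hx
  have hint : IsIntegral ℤ x := by
    apply IsIntegral.of_pow (n := 2) (by norm_num)
    rw [hx]; simpa using isIntegral_algebraMap (R := ℤ) (A := F) (x := (2 : ℤ))
  obtain ⟨y, rfl⟩ := exists_coe_eq_of_isIntegral hint
  obtain ⟨a, -, -, ha, -⟩ := exists_int_of_sum_sq_eq_four hd h6 hs hgen
    (x := y) (y := y) (z := 0) (by
      apply RingOfIntegers.coe_injective
      simp only [map_add, map_pow, map_zero, map_ofNat]
      linear_combination 2 * hx)
  rw [ha, map_intCast] at hx
  have hx' : a ^ 2 = 2 := by exact_mod_cast hx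
  have : a < 2 := by nlinarith
  have : -2 < a := by nlinarith
  interval_cases a <;> omega

omit [NumberField F] in
/-- A positive unit is a power of the fundamental unit. -/
theorem exists_zpow_eq_of_pos (σ₀ : F →+* ℝ) (ε : (𝓞 F)ˣ)
    (hε : 1 < σ₀ (algebraMap (𝓞 F) F ↑ε))
    (hεfund : ∀ u : (𝓞 F)ˣ, 1 < σ₀ (algebraMap (𝓞 F) F ↑u) →
      σ₀ (algebraMap (𝓞 F) F ↑ε) ≤ σ₀ (algebraMap (𝓞 F) F ↑u))
    (η : (𝓞 F)ˣ) (hη : 0 < σ₀ (algebraMap (𝓞 F) F ↑η)) : ∃ k : ℤ, η = ε ^ k := by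
  obtain ⟨k, hk1, hk2⟩ := exists_mem_Ico_zpow hη hε
  set f : (𝓞 F)ˣ →* ℝˣ := Units.map ((σ₀.comp (algebraMap (𝓞 F) F) : 𝓞 F →+* ℝ) : 𝓞 F →* ℝ)
    with hf
  have hval : ∀ u : (𝓞 F)ˣ, σ₀ (algebraMap (𝓞 F) F ↑u) = (f u : ℝ) := fun u => rfl
  have hinj : Function.Injective f :=
    Units.map_injective (σ₀.injective.comp RingOfIntegers.coe_injective)
  simp only [hval] at *
  have hpos : (0 : ℝ) < (f ε : ℝ) ^ k := zpow_pos (by linarith) k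
  have hq : ((f (η * (ε ^ k)⁻¹) : ℝˣ) : ℝ) = (f η : ℝ) / (f ε : ℝ) ^ k := by
    rw [map_mul, map_inv, map_zpow]; push_cast; rw [div_eq_mul_inv]
  refine ⟨k, ?_⟩
  by_contra hne
  have hge : 1 ≤ ((f (η * (ε ^ k)⁻¹) : ℝˣ) : ℝ) := by rw [hq]; rwa [one_le_div hpos]
  have hgt : 1 < ((f (η * (ε ^ k)⁻¹) : ℝˣ) : ℝ) := by
    refine lt_of_le_of_ne hge fun h => hne ?_
    have : f (η * (ε ^ k)⁻¹) = f 1 := by rw [map_one]; exact Units.ext h.symm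
    exact mul_inv_eq_one.1 (hinj this)
  have := hεfund _ hgt
  rw [hq, le_div_iff₀ hpos, mul_comm, ← zpow_add_one₀ (by linarith)] at this
  linarith

/-- If twice the square of a field element is a unit, then `2 * ε` is a square. -/
theorem two_mul_fundamentalUnit_eq_sq {s : F} {d : ℕ} (hd : Squarefree d) (h6 : 6 ≤ d)
    (hs : s ^ 2 = (d : F)) (hgen : Algebra.adjoin ℚ {s} = ⊤) (σ₀ : F →+* ℝ) (ε : (𝓞 F)ˣ)
    (hε : 1 < σ₀ (algebraMap (𝓞 F) F ↑ε))
    (hεfund : ∀ u : (𝓞 F)ˣ, 1 < σ₀ (algebraMap (𝓞 F) F ↑u) →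
      σ₀ (algebraMap (𝓞 F) F ↑ε) ≤ σ₀ (algebraMap (𝓞 F) F ↑u))
    (η : (𝓞 F)ˣ) (c : F) (hc : 2 * c ^ 2 = algebraMap (𝓞 F) F ↑η) :
    ∃ t : F, 2 * algebraMap (𝓞 F) F ↑ε = t ^ 2 := by
  have hc0 : c ≠ 0 := by
    rintro rfl
    have : algebraMap (𝓞 F) F ↑η = 0 := by rw [← hc]; simp
    exact η.ne_zero (RingOfIntegers.coe_injective (by rw [this, map_zero]))
  have hpos : 0 < σ₀ (algebraMap (𝓞 F) F ↑η) := by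
    rw [← hc, map_mul, map_pow, map_ofNat]
    have : σ₀ c ≠ 0 := by simpa using hc0
    positivity
  obtain ⟨k, rfl⟩ := exists_zpow_eq_of_pos σ₀ ε hε hεfund η hpos
  set e : F := algebraMap (𝓞 F) F ↑ε with he
  have he0 : e ≠ 0 := by
    intro h
    exact ε.ne_zero (RingOfIntegers.coe_injective (by rw [← he, h]; simp))
  have hk : algebraMap (𝓞 F) F ↑(ε ^ k) = e ^ k := by
    have := congrArg Units.val (map_zpow (Units.map (algebraMap (𝓞 F) F : 𝓞 F →* F)) ε k)
    rwa [Units.val_zpow_eq_zpow_val] at this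
  rw [hk] at hc
  rcases Int.even_or_odd' k with ⟨l, rfl | rfl⟩
  · exfalso
    rw [two_mul l, zpow_add₀ he0] at hc
    refine two_ne_sq hd h6 hs hgen (e ^ l / c) ?_
    rw [div_pow, sq (e ^ l), ← hc]; field_simp
  · rw [zpow_add_one₀ he0, two_mul l, zpow_add₀ he0] at hc
    have hl : e ^ l ≠ 0 := zpow_ne_zero _ he0
    refine ⟨2 * c / e ^ l, ?_⟩
    field_simp
    linear_combination -hc

end QuadraticField

section Orders

variable {F : Type} [Field F] [NumberField F]

/-- The element with integral coordinates `a b c d` in the basis `(1 + i + j + k) / 2, i, j, k`. -/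
def hurwitz (a b c d : 𝓞 F) : ℍ[F, -1, -1] :=
  ⟨algebraMap (𝓞 F) F a / 2, algebraMap (𝓞 F) F a / 2 + algebraMap (𝓞 F) F b,
    algebraMap (𝓞 F) F a / 2 + algebraMap (𝓞 F) F c,
    algebraMap (𝓞 F) F a / 2 + algebraMap (𝓞 F) F d⟩

theorem hurwitz_mul (a b c d e f g h : 𝓞 F) : hurwitz a b c d * hurwitz e f g h = hurwitz
    (-a*e - a*f - a*g - a*h - b*e - 2*b*f - c*e - 2*c*g - d*e - 2*d*h)
    (a*e + a*f + a*h + b*e + b*f + c*e + c*g + c*h - d*g + d*h)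
    (a*e + a*f + a*g + b*f - b*h + c*e + c*g + d*e + d*f + d*h)
    (a*e + a*g + a*h + b*e + b*f + b*g - c*f + c*g + d*e + d*h) := by
  ext <;> simp [hurwitz, map_ofNat] <;> ring

/-- The order spanned by the Hurwitz quaternions. -/
def hurwitzOrder (F : Type) [Field F] [NumberField F] : Subring ℍ[F, -1, -1] where
  carrier := {x | ∃ a b c d : 𝓞 F, x = hurwitz a b c d}
  mul_mem' := by
    rintro _ _ ⟨a, b, c, d, rfl⟩ ⟨e, f, g, h, rfl⟩
    exact ⟨_, _, _, _, hurwitz_mul ..⟩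
  one_mem' := ⟨2, -1, -1, -1, by ext <;> simp [hurwitz, map_ofNat]⟩
  add_mem' := by
    rintro _ _ ⟨a, b, c, d, rfl⟩ ⟨e, f, g, h, rfl⟩
    exact ⟨a + e, b + f, c + g, d + h, by ext <;> simp [hurwitz] <;> ring⟩
  zero_mem' := ⟨0, 0, 0, 0, by ext <;> simp [hurwitz]⟩
  neg_mem' := by
    rintro _ ⟨a, b, c, d, rfl⟩
    exact ⟨-a, -b, -c, -d, by ext <;> simp [hurwitz] <;> ring⟩

theorem hurwitz_mem (a b c d : 𝓞 F) : hurwitz a b c d ∈ hurwitzOrder F := ⟨a, b, c, d, rfl⟩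

/-- The element `(1 - i) (p + q ω) / 2`, where `ω = (1 + i + j + k) / 2`. -/
def glue (p q : 𝓞 F) : ℍ[F, -1, -1] :=
  ⟨(algebraMap (𝓞 F) F p + algebraMap (𝓞 F) F q) / 2, -algebraMap (𝓞 F) F p / 2,
    algebraMap (𝓞 F) F q / 2, 0⟩

theorem exists_glue_mul (p q : 𝓞 F) {x : ℍ[F, -1, -1]} (hx : x ∈ hurwitzOrder F) :
    ∃ y ∈ hurwitzOrder F, ∃ w ∈ hurwitzOrder F, glue p q * x = y * glue p q + w := by
  obtain ⟨a, b, c, d, rfl⟩ := hx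
  exact ⟨_, hurwitz_mem a b d (-a - c), _, hurwitz_mem (-c*q + d*q) 0 (c*q - d*q) (-b*q + c*q),
    by ext <;> simp [hurwitz, glue] <;> ring⟩

theorem glue_mul_glue {p q κ : 𝓞 F} (h : p ^ 2 + p * q + q ^ 2 = 2 * κ) :
    glue p q * glue p q = hurwitz q 0 0 (-q) * glue p q + hurwitz 0 (-κ) 0 0 := by
  have h' := congrArg (algebraMap (𝓞 F) F) h
  simp only [map_add, map_mul, map_pow, map_ofNat] at h'
  ext <;> simp [hurwitz, glue]
  · ring
  · linear_combination -h' / 2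
  · ring
  · ring

/-- The order generated over the Hurwitz order by `glue p q`. -/
def gluedOrder (p q κ : 𝓞 F) (h : p ^ 2 + p * q + q ^ 2 = 2 * κ) : Subring ℍ[F, -1, -1] where
  carrier := {x | ∃ u ∈ hurwitzOrder F, ∃ v ∈ hurwitzOrder F, x = u + v * glue p q}
  mul_mem' := by
    rintro _ _ ⟨u, hu, v, hv, rfl⟩ ⟨u', hu', v', hv', rfl⟩
    obtain ⟨y, hy, w, hw, h1⟩ := exists_glue_mul p q hu'
    obtain ⟨y', hy', w', hw', h2⟩ := exists_glue_mul p q hv'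
    refine ⟨u * u' + v * w + v * y' * hurwitz 0 (-κ) 0 0, ?_,
      v * y + u * v' + v * w' + v * y' * hurwitz q 0 0 (-q), ?_, ?_⟩
    · exact add_mem (add_mem (mul_mem hu hu') (mul_mem hv hw))
        (mul_mem (mul_mem hv hy') (hurwitz_mem ..))
    · exact add_mem (add_mem (add_mem (mul_mem hv hy) (mul_mem hu hv')) (mul_mem hv hw'))
        (mul_mem (mul_mem hv hy') (hurwitz_mem ..))
    · have h3 := glue_mul_glue h
      calc (u + v * glue p q) * (u' + v' * glue p q)
          = u * u' + v * (glue p q * u') + u * v' * glue p q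
            + v * (glue p q * v') * glue p q := by noncomm_ring
        _ = u * u' + v * w + v * y * glue p q + u * v' * glue p q
            + v * y' * (glue p q * glue p q) + v * w' * glue p q := by
              rw [h1, h2]; noncomm_ring
        _ = _ := by rw [h3]; noncomm_ring
  one_mem' := ⟨1, one_mem _, 0, zero_mem _, by simp⟩
  add_mem' := by
    rintro _ _ ⟨u, hu, v, hv, rfl⟩ ⟨u', hu', v', hv', rfl⟩
    exact ⟨_, add_mem hu hu', _, add_mem hv hv', by noncomm_ring⟩
  zero_mem' := ⟨0, zero_mem _, 0, zero_mem _, by simp⟩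
  neg_mem' := by
    rintro _ ⟨u, hu, v, hv, rfl⟩
    exact ⟨_, neg_mem hu, _, neg_mem hv, by noncomm_ring⟩

theorem hurwitzOrder_le_gluedOrder (p q κ : 𝓞 F) (h : p ^ 2 + p * q + q ^ 2 = 2 * κ) :
    hurwitzOrder F ≤ gluedOrder p q κ h :=
  fun x hx => ⟨x, hx, 0, zero_mem _, by simp⟩

theorem glue_mem_gluedOrder (p q κ : 𝓞 F) (h : p ^ 2 + p * q + q ^ 2 = 2 * κ) :
    glue p q ∈ gluedOrder p q κ h :=
  ⟨0, zero_mem _, 1, one_mem _, by simp⟩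

theorem algebraMap_mem_hurwitzOrder (r : 𝓞 F) :
    algebraMap F ℍ[F, -1, -1] (algebraMap (𝓞 F) F r) ∈ hurwitzOrder F :=
  ⟨2 * r, -r, -r, -r, by
    ext <;> simp [hurwitz, map_ofNat, QuaternionAlgebra.algebraMap_eq]⟩

theorem fg_toAddSubgroup_of_coords (O : Subring ℍ[F, -1, -1])
    (h : ∀ x ∈ O, ∃ a b c d : 𝓞 F, x = ⟨algebraMap (𝓞 F) F a / 2, algebraMap (𝓞 F) F b / 2,
      algebraMap (𝓞 F) F c / 2, algebraMap (𝓞 F) F d / 2⟩) : O.toAddSubgroup.FG := by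
  let f : (𝓞 F × 𝓞 F × 𝓞 F × 𝓞 F) →+ ℍ[F, -1, -1] :=
    { toFun := fun r => ⟨algebraMap (𝓞 F) F r.1 / 2, algebraMap (𝓞 F) F r.2.1 / 2,
        algebraMap (𝓞 F) F r.2.2.1 / 2, algebraMap (𝓞 F) F r.2.2.2 / 2⟩
      map_zero' := by ext <;> simp
      map_add' := fun x y => by ext <;> simp [add_div] }
  have hN : IsNoetherian ℤ (LinearMap.range f.toIntLinearMap) := inferInstance
  have hle : AddSubgroup.toIntSubmodule O.toAddSubgroup ≤ LinearMap.range f.toIntLinearMap := by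
    intro x hx
    obtain ⟨a, b, c, d, rfl⟩ := h x hx
    exact ⟨(a, b, c, d), rfl⟩
  have := (Submodule.fg_iff_addSubgroup_fg _).1 (isNoetherian_submodule.1 hN _ hle)
  rwa [AddSubgroup.toIntSubmodule_toAddSubgroup] at this

theorem isOrder_gluedOrder (p q κ : 𝓞 F) (h : p ^ 2 + p * q + q ^ 2 = 2 * κ) :
    IsOrder F (gluedOrder p q κ h) := by
  have hle := hurwitzOrder_le_gluedOrder p q κ h
  refine ⟨?_, ?_, ?_⟩
  · rintro _ ⟨r, rfl⟩
    exact hle (algebraMap_mem_hurwitzOrder r)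
  · refine fg_toAddSubgroup_of_coords _ ?_
    rintro _ ⟨_, ⟨a, b, c, d, rfl⟩, _, ⟨e, f, g, h, rfl⟩, rfl⟩
    exact ⟨a + e * p + f * p - g * q, a + 2 * b + f * p + f * q - h * q,
      a + 2 * c + e * q + g * p + g * q - h * p,
      a + 2 * d + e * p + e * q + f * q + g * p + h * p + h * q, by
        ext <;> simp [hurwitz, glue, map_ofNat] <;> ring⟩
  · rw [eq_top_iff]
    intro x _
    have hb : ∀ a b c d : 𝓞 F,
        hurwitz a b c d ∈ Submodule.span F (gluedOrder p q κ h : Set ℍ[F, -1, -1]) :=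
      fun a b c d => Submodule.subset_span (hle (hurwitz_mem a b c d))
    have : x = x.re • hurwitz 2 (-1) (-1) (-1) + x.imI • hurwitz 0 1 0 0
        + x.imJ • hurwitz 0 0 1 0 + x.imK • hurwitz 0 0 0 1 := by
      ext <;> simp [hurwitz, map_ofNat]
    rw [this]
    exact add_mem (add_mem (add_mem (Submodule.smul_mem _ _ (hb _ _ _ _))
      (Submodule.smul_mem _ _ (hb _ _ _ _))) (Submodule.smul_mem _ _ (hb _ _ _ _)))
      (Submodule.smul_mem _ _ (hb _ _ _ _))

end Orders

section Transport

variable {F : Type} [Field F] {H H' : Type} [Ring H] [Algebra F H] [Ring H']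
  [Algebra F H']

theorem IsOrder.isIntegral {O : Subring H} (hO : IsOrder F O) {x : H} (hx : x ∈ O) :
    IsIntegral ℤ x := by
  have hfg : (Subalgebra.toSubmodule (subalgebraOfSubring O)).FG :=
    (Submodule.fg_iff_addSubgroup_fg _).2 hO.2.1
  exact IsIntegral.of_mem_of_fg _ hfg x hx

theorem IsOrder.comap {O : Subring H} (hO : IsOrder F O) (e : H' ≃ₐ[F] H) :
    IsOrder F (O.comap (e : H' →+* H)) := by
  have himg : ((O.comap (e : H' →+* H) : Subring H') : Set H') = e.symm '' (O : Set H) := by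
    ext x
    refine ⟨fun hx => ⟨e x, hx, e.symm_apply_apply x⟩, ?_⟩
    rintro ⟨y, hy, rfl⟩
    simpa using hy
  refine ⟨?_, ?_, ?_⟩
  · rintro _ ⟨r, rfl⟩
    simpa using hO.1 ⟨r, rfl⟩
  · have : (O.comap (e : H' →+* H)).toAddSubgroup =
        O.toAddSubgroup.map (e.symm : H ≃+ H').toAddMonoidHom := by
      apply SetLike.coe_injective
      exact himg
    rw [this]
    obtain ⟨S, hS⟩ := hO.2.1
    classical
    refine ⟨S.image e.symm, ?_⟩
    rw [← hS, AddMonoidHom.map_closure]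
    simp
    rfl
  · have := congrArg (Submodule.map e.symm.toLinearMap) hO.2.2
    rw [Submodule.map_span, Submodule.map_top, LinearMap.range_eq_top.2 e.symm.surjective] at this
    rw [himg]
    exact this

theorem comap_comap_symm (O : Subring H) (e : H' ≃ₐ[F] H) :
    (O.comap (e : H' →+* H)).comap (e.symm : H →+* H') = O := by
  ext x; simp

theorem IsMaximalOrder.comap {O : Subring H} (hO : IsMaximalOrder F O) (e : H' ≃ₐ[F] H) :
    IsMaximalOrder F (O.comap (e : H' →+* H)) := by
  refine ⟨hO.1.comap e, fun O' hO' hle => ?_⟩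
  have h := hO.2 _ (hO'.comap e.symm) (fun x hx => by
    change e.symm x ∈ O'
    exact hle (by simpa using hx))
  rw [← h]
  exact (comap_comap_symm O' e.symm).symm

theorem RedUnitIso.comap {G : Type*} [Group G] {O : Subring H} (hO : RedUnitIso F O G)
    (e : H' ≃ₐ[F] H) : RedUnitIso F (O.comap (e : H' →+* H)) G := by
  obtain ⟨φ, hφ, hker⟩ := hO
  let g : (O.comap (e : H' →+* H)) ≃* O :=
    { toFun := fun x => ⟨e x, x.2⟩
      invFun := fun x => ⟨e.symm x, by simp⟩
      left_inv := fun x => by simp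
      right_inv := fun x => by simp
      map_mul' := fun x y => by ext; simp }
  refine ⟨φ.comp (Units.mapEquiv g).toMonoidHom, hφ.comp (Units.mapEquiv g).surjective,
    fun u => ?_⟩
  refine (hker _).trans (exists_congr fun r => ?_)
  change e (u : O.comap (e : H' →+* H)) = _ ↔ _
  rw [← e.symm.injective.eq_iff]
  simp

end Transport

section Coordinates

variable {F : Type} [Field F] [NumberField F]

theorem exists_trace_norm {x : ℍ[F, -1, -1]} (hx : IsIntegral ℤ x) :
    (∃ t : 𝓞 F, algebraMap (𝓞 F) F t = 2 * x.re) ∧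
      ∃ n : 𝓞 F, algebraMap (𝓞 F) F n = x.re ^ 2 + x.imI ^ 2 + x.imJ ^ 2 + x.imK ^ 2 := by
  by_cases hs : ∀ r : F, algebraMap F ℍ[F, -1, -1] r ≠ x
  · refine exists_algebraMap_eq_of_quadratic (R := 𝓞 F) hx ?_ hs
    ext <;> simp [QuaternionAlgebra.algebraMap_eq] <;> ring
  · push Not at hs
    obtain ⟨r, rfl⟩ := hs
    have hr : IsIntegral ℤ r :=
      (isIntegral_algebraMap_iff (FaithfulSMul.algebraMap_injective F ℍ[F, -1, -1])).1 hx
    obtain ⟨r, rfl⟩ := exists_coe_eq_of_isIntegral hr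
    exact ⟨⟨2 * r, by simp [QuaternionAlgebra.algebraMap_eq, map_ofNat]⟩,
      ⟨r ^ 2, by simp [QuaternionAlgebra.algebraMap_eq]⟩⟩

theorem IsOrder.exists_coords {O : Subring ℍ[F, -1, -1]} (hO : IsOrder F O)
    (hle : hurwitzOrder F ≤ O) {x : ℍ[F, -1, -1]} (hx : x ∈ O) :
    ∃ A B C D : 𝓞 F, x = ⟨algebraMap (𝓞 F) F A / 2, algebraMap (𝓞 F) F B / 2,
      algebraMap (𝓞 F) F C / 2, algebraMap (𝓞 F) F D / 2⟩ ∧ 2 ∣ A + B + C + D ∧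
      4 ∣ A ^ 2 + B ^ 2 + C ^ 2 + D ^ 2 := by
  have htr : ∀ a b c d : 𝓞 F, ∃ t : 𝓞 F, algebraMap (𝓞 F) F t = 2 * (x * hurwitz a b c d).re :=
    fun a b c d => (exists_trace_norm (hO.isIntegral (mul_mem hx (hle (hurwitz_mem a b c d))))).1
  obtain ⟨⟨A, hA⟩, n, hn⟩ := exists_trace_norm (hO.isIntegral hx)
  obtain ⟨B, hB⟩ := htr 0 (-1) 0 0
  obtain ⟨C, hC⟩ := htr 0 0 (-1) 0
  obtain ⟨D, hD⟩ := htr 0 0 0 (-1)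
  obtain ⟨E, hE⟩ := htr 1 0 0 0
  simp [hurwitz] at hB hC hD hE
  refine ⟨A, B, C, D, ?_, ⟨A - E, ?_⟩, ⟨n, ?_⟩⟩
  · ext <;> simp [hA, hB, hC, hD]
  · apply RingOfIntegers.coe_injective
    simp only [map_add, map_mul, map_sub, map_ofNat, hA, hB, hC, hD, hE]
    ring
  · apply RingOfIntegers.coe_injective
    simp only [map_add, map_mul, map_pow, map_ofNat, hA, hB, hC, hD, hn]
    ring

theorem IsOrder.hurwitzOrder_le {O : Subring ℍ[F, -1, -1]} (hO : IsOrder F O)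
    (hi : hurwitz 0 1 0 0 ∈ O) (hj : hurwitz 0 0 1 0 ∈ O) (hω : hurwitz 1 0 0 0 ∈ O) :
    hurwitzOrder F ≤ O := by
  rintro _ ⟨a, b, c, d, rfl⟩
  have hs : ∀ r : 𝓞 F, algebraMap F ℍ[F, -1, -1] (algebraMap (𝓞 F) F r) ∈ O :=
    fun r => hO.1 ⟨r, rfl⟩
  have : hurwitz a b c d = algebraMap F ℍ[F, -1, -1] (algebraMap (𝓞 F) F a) * hurwitz 1 0 0 0
      + algebraMap F ℍ[F, -1, -1] (algebraMap (𝓞 F) F b) * hurwitz 0 1 0 0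
      + algebraMap F ℍ[F, -1, -1] (algebraMap (𝓞 F) F c) * hurwitz 0 0 1 0
      + algebraMap F ℍ[F, -1, -1] (algebraMap (𝓞 F) F d)
        * (hurwitz 0 1 0 0 * hurwitz 0 0 1 0) := by
    ext <;> simp [hurwitz, QuaternionAlgebra.algebraMap_eq] <;> ring
  rw [this]
  exact add_mem (add_mem (add_mem (mul_mem (hs a) hω) (mul_mem (hs b) hi)) (mul_mem (hs c) hj))
    (mul_mem (hs d) (mul_mem hi hj))

theorem mem_gluedOrder_of_coords {p q κ : 𝓞 F} (h : p ^ 2 + p * q + q ^ 2 = 2 * κ)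
    {A B C D m n : 𝓞 F} (hs : 2 ∣ A + B + C + D) (hB : 2 ∣ B - D - (m * p + n * (p + q)))
    (hC : 2 ∣ C - D - (m * q + n * p)) :
    (⟨algebraMap (𝓞 F) F A / 2, algebraMap (𝓞 F) F B / 2, algebraMap (𝓞 F) F C / 2,
      algebraMap (𝓞 F) F D / 2⟩ : ℍ[F, -1, -1]) ∈ gluedOrder p q κ h := by
  obtain ⟨E, hE⟩ := hs
  obtain ⟨G, hG⟩ := hB
  obtain ⟨I, hI⟩ := hC
  obtain rfl : B = D + (m * p + n * (p + q)) + 2 * G := by linear_combination hG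
  obtain rfl : C = D + (m * q + n * p) + 2 * I := by linear_combination hI
  obtain rfl :
      A = 2 * E - (D + (m * p + n * (p + q)) + 2 * G) - (D + (m * q + n * p) + 2 * I) - D :=
    by linear_combination hE
  set d := 2 * D - E + G + I + m * p + m * q + n * p with hd
  refine ⟨_, hurwitz_mem (2 * E - (D + (m * p + n * (p + q)) + 2 * G)
      - (D + (m * q + n * p) + 2 * I) - D - (m + n) * p - m * q)
    (d + G + m * p + n * p + n * q) (d + I + n * p) d,
    _, hurwitz_mem (2 * m + n) (-m) (-m) (-m), ?_⟩
  ext <;> simp [hurwitz, glue, hd, map_ofNat] <;> ring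

theorem two_dvd_of_four_dvd {A B C D : 𝓞 F} (hs : 2 ∣ A + B + C + D)
    (h4 : 4 ∣ A ^ 2 + B ^ 2 + C ^ 2 + D ^ 2) :
    2 ∣ (B - D) ^ 2 + (B - D) * (C - D) + (C - D) ^ 2 := by
  obtain ⟨E, hE⟩ := hs
  obtain ⟨N, hN⟩ := h4
  obtain rfl : A = 2 * E - B - C - D := by linear_combination hE
  refine ⟨N - E ^ 2 + E * (B + C + D) - 2 * (B * D + C * D) + D ^ 2, ?_⟩
  have h2 : (2 : 𝓞 F) ≠ 0 := two_ne_zero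
  apply mul_left_cancel₀ h2
  linear_combination hN

end Coordinates

section KeyOrder

variable {F : Type} [Field F] [NumberField F]

theorem exists_glue_params {s : F} {d : ℕ} (hd : Squarefree d) (h2 : 2 ≤ d)
    (hs : s ^ 2 = (d : F)) (hgen : Algebra.adjoin ℚ {s} = ⊤) :
    ∃ p q κ : 𝓞 F, p ^ 2 + p * q + q ^ 2 = 2 * κ ∧
      ∀ a b : 𝓞 F, 2 ∣ a ^ 2 + a * b + b ^ 2 → ∃ m n : 𝓞 F, 2 ∣ b - (m * q + n * p) ∧
        (2 ∣ a - (m * p + n * (p + q)) ∨ 2 ∣ a + b - (m * p + n * (p + q))) := by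
  obtain ⟨θ, hθ, hpar, hθ2⟩ := exists_quadratic_generator hd h2 hs hgen
  have hz : ∀ z : ℤ, (2 : ℤ) ∣ z ↔ (z : ZMod 2) = 0 := fun z =>
    ((ZMod.intCast_zmod_eq_zero_iff_dvd z 2).symm)
  have hcast : ∀ m n : ℤ, 2 ∣ m → 2 ∣ n → (2 : 𝓞 F) ∣ m + n * θ := by
    rintro _ _ ⟨m, rfl⟩ ⟨n, rfl⟩
    exact ⟨m + n * θ, by push_cast; ring⟩
  rcases hθ2 with ⟨k, hk⟩ | ⟨l, hl⟩
  · rcases Int.even_or_odd' k with ⟨κ, rfl | rfl⟩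
    · refine ⟨0, 0, 0, by ring, fun a b hab => ⟨0, 0, ?_⟩⟩
      obtain ⟨m, n, rfl⟩ := hθ a
      obtain ⟨p, q, rfl⟩ := hθ b
      have h := hpar (m ^ 2 + n ^ 2 * (2 * κ) + m * p + n * q * (2 * κ) + p ^ 2 + q ^ 2 * (2 * κ))
        (2 * m * n + n ^ 2 + m * q + n * p + n * q + 2 * p * q + q ^ 2) (by
          convert hab using 1
          push_cast at hk ⊢
          linear_combination (-n ^ 2 - n * q - q ^ 2 : 𝓞 F) * hk)
      have key : ∀ m n p q κ : ZMod 2,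
          m ^ 2 + n ^ 2 * (2 * κ) + m * p + n * q * (2 * κ) + p ^ 2 + q ^ 2 * (2 * κ) = 0 ∧
          2 * m * n + n ^ 2 + m * q + n * p + n * q + 2 * p * q + q ^ 2 = 0 →
          m = 0 ∧ n = 0 ∧ p = 0 ∧ q = 0 := by decide
      simp only [hz] at h hcast
      push_cast at h
      obtain ⟨hm, hn, hp, hq⟩ := key _ _ _ _ _ h
      exact ⟨by simpa using hcast _ _ hp hq, Or.inl (by simpa using hcast _ _ hm hn)⟩
    · refine ⟨θ, 1, θ + κ + 1, ?_, fun a b hab => ⟨b, 0, by simp, ?_⟩⟩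
      · push_cast at hk
        linear_combination hk
      obtain ⟨m, n, rfl⟩ := hθ a
      obtain ⟨p, q, rfl⟩ := hθ b
      have h := hpar (m ^ 2 + n ^ 2 * (2 * κ + 1) + m * p + n * q * (2 * κ + 1) + p ^ 2
          + q ^ 2 * (2 * κ + 1))
        (2 * m * n + n ^ 2 + m * q + n * p + n * q + 2 * p * q + q ^ 2) (by
          convert hab using 1
          push_cast at hk ⊢
          linear_combination (-n ^ 2 - n * q - q ^ 2 : 𝓞 F) * hk)
      have key : ∀ m n p q κ : ZMod 2,
          m ^ 2 + n ^ 2 * (2 * κ + 1) + m * p + n * q * (2 * κ + 1) + p ^ 2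
            + q ^ 2 * (2 * κ + 1) = 0 ∧
          2 * m * n + n ^ 2 + m * q + n * p + n * q + 2 * p * q + q ^ 2 = 0 →
          (m - q * (2 * κ + 1) = 0 ∧ n - p - q = 0) ∨
            (m + p - q * (2 * κ + 1) = 0 ∧ n + q - p - q = 0) := by decide
      simp only [hz] at h hcast
      push_cast at h
      refine (key _ _ _ _ _ h).imp (fun h' => ?_) (fun h' => ?_)
      · have := hcast (m - q * (2 * κ + 1)) (n - p - q)
          (by push_cast; exact h'.1) (by push_cast; exact h'.2)
        convert this using 1
        push_cast at hk ⊢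
        linear_combination (-q : 𝓞 F) * hk
      · have := hcast (m + p - q * (2 * κ + 1)) (n + q - p - q)
          (by push_cast; exact h'.1) (by push_cast; exact h'.2)
        convert this using 1
        push_cast at hk ⊢
        linear_combination (-q : 𝓞 F) * hk
  · refine ⟨θ, 0, l, by rw [← hl]; ring, fun a b hab => ?_⟩
    obtain ⟨m, n, rfl⟩ := hθ a
    obtain ⟨p, q, rfl⟩ := hθ b
    obtain ⟨w, hw⟩ := hab
    have h := hpar (m ^ 2 + m * p + p ^ 2) (2 * m * n + m * q + n * p + 2 * p * q)
      ⟨w - l * (n ^ 2 + n * q + q ^ 2), by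
        push_cast
        linear_combination hw - (n ^ 2 + n * q + q ^ 2 : 𝓞 F) * hl⟩
    have key : ∀ m n p q : ZMod 2, m ^ 2 + m * p + p ^ 2 = 0 ∧
        2 * m * n + m * q + n * p + 2 * p * q = 0 → m = 0 ∧ p = 0 := by decide
    simp only [hz] at h
    push_cast at h
    obtain ⟨hm, hp⟩ := key _ _ _ _ h
    obtain ⟨m, rfl⟩ := (hz _).2 hm
    obtain ⟨p, rfl⟩ := (hz _).2 hp
    exact ⟨n - q, q, ⟨p, by push_cast; ring⟩, Or.inl ⟨m, by push_cast; ring⟩⟩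

/-- Conjugation by `(1 + i)⁻¹`. -/
def twist (F : Type) [Field F] : ℍ[F, -1, -1] ≃ₐ[F] ℍ[F, -1, -1] where
  toFun x := ⟨x.re, x.imI, x.imK, -x.imJ⟩
  invFun x := ⟨x.re, x.imI, -x.imK, x.imJ⟩
  left_inv x := by ext <;> simp
  right_inv x := by ext <;> simp
  map_mul' x y := by ext <;> simp <;> ring
  map_add' x y := by ext <;> simp [add_comm]
  commutes' r := by ext <;> simp [QuaternionAlgebra.algebraMap_eq]

omit [NumberField F] in
theorem twist_twist_mul (x : ℍ[F, -1, -1]) :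
    x = hurwitz 0 1 0 0 * twist F (twist F x) * hurwitz 0 (-1) 0 0 := by
  ext <;> simp [hurwitz, twist]

theorem Subring.le_or_le_of_forall_mem {R : Type*} [Ring R] {O M N : Subring R}
    (h : ∀ x ∈ O, x ∈ M ∨ x ∈ N) : O ≤ M ∨ O ≤ N := by
  by_contra! hc
  obtain ⟨⟨x, hx, hxM⟩, y, hy, hyN⟩ := And.imp SetLike.not_le_iff_exists.1
    SetLike.not_le_iff_exists.1 hc
  have hxN := (h x hx).resolve_left hxM
  have hyM := (h y hy).resolve_right hyN
  rcases h _ (add_mem hx hy) with h' | h'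
  · exact hxM (by simpa using sub_mem h' hyM)
  · exact hyN (by simpa using sub_mem h' hxN)

/-- There is a maximal order containing the Hurwitz quaternions such that it and its conjugate by
`1 + i` contain every order containing the Hurwitz quaternions. -/
theorem exists_maximalOrder {s : F} {d : ℕ} (hd : Squarefree d) (h2 : 2 ≤ d)
    (hs : s ^ 2 = (d : F)) (hgen : Algebra.adjoin ℚ {s} = ⊤) :
    ∃ M : Subring ℍ[F, -1, -1], IsMaximalOrder F M ∧ hurwitzOrder F ≤ M ∧
      ∀ O : Subring ℍ[F, -1, -1], IsOrder F O → hurwitzOrder F ≤ O →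
        O ≤ M ∨ O ≤ M.comap (twist F : ℍ[F, -1, -1] →+* ℍ[F, -1, -1]) := by
  obtain ⟨p, q, κ, h, hpq⟩ := exists_glue_params hd h2 hs hgen
  have hle := hurwitzOrder_le_gluedOrder p q κ h
  have hdich : ∀ O : Subring ℍ[F, -1, -1], IsOrder F O → hurwitzOrder F ≤ O →
      O ≤ gluedOrder p q κ h ∨
        O ≤ (gluedOrder p q κ h).comap (twist F : ℍ[F, -1, -1] →+* ℍ[F, -1, -1]) := by
    refine fun O hO hle => Subring.le_or_le_of_forall_mem fun x hx => ?_
    obtain ⟨A, B, C, D, rfl, hsum, h4⟩ := hO.exists_coords hle hx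
    obtain ⟨m, n, hb, ha⟩ := hpq _ _ (two_dvd_of_four_dvd hsum h4)
    refine ha.imp (fun ha => mem_gluedOrder_of_coords h hsum ha hb) (fun ha => ?_)
    have := mem_gluedOrder_of_coords h (A := A) (B := B) (C := D) (D := -C) (m := m) (n := n)
      ?_ ?_ ?_
    · rw [map_neg, neg_div] at this
      exact this
    · convert dvd_sub hsum (dvd_mul_right 2 C) using 1
      ring
    · convert dvd_add ha (dvd_mul_right 2 D) using 1
      ring
    · convert dvd_add hb (dvd_mul_right 2 D) using 1
      ring
  refine ⟨gluedOrder p q κ h, ⟨isOrder_gluedOrder p q κ h, fun O hO hMO => ?_⟩, hle, hdich⟩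
  rcases hdich O hO (hle.trans hMO) with hOM | hOM
  · exact le_antisymm hOM hMO
  · refine le_antisymm (fun x hx => ?_) hMO
    rw [twist_twist_mul x]
    have h1 : twist F x ∈ gluedOrder p q κ h := hOM hx
    have h2 : twist F (twist F x) ∈ gluedOrder p q κ h := hOM (hMO h1)
    exact mul_mem (mul_mem (hle (hurwitz_mem ..)) h2) (hle (hurwitz_mem ..))

end KeyOrder

section NotA4

variable {F : Type} [Field F] [NumberField F]

theorem alternatingGroup_four_pow_two : ∀ g : alternatingGroup (Fin 4), g ^ 4 = 1 → g ^ 2 = 1 := by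
  decide

theorem not_redUnitIso_of_glue_mem {O : Subring ℍ[F, -1, -1]} (hle : hurwitzOrder F ≤ O)
    {t : 𝓞 F} {ε : (𝓞 F)ˣ} (h : t ^ 2 = 2 * ε) (ht : glue t 0 ∈ O) :
    ¬ RedUnitIso F O (alternatingGroup (Fin 4)) := by
  rintro ⟨φ, -, hφ⟩
  have hF := congrArg (algebraMap (𝓞 F) F) h
  simp only [map_pow, map_mul, map_ofNat] at hF
  obtain ⟨η, hη⟩ : ∃ η : 𝓞 F, algebraMap (𝓞 F) F η * algebraMap (𝓞 F) F (ε : 𝓞 F) = 1 :=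
    ⟨(ε⁻¹ : (𝓞 F)ˣ), by rw [← map_mul, Units.inv_mul, map_one]⟩
  have ha := hle (hurwitz_mem 0 η 0 0)
  let u : (↥O)ˣ :=
    { val := ⟨_, ht⟩
      inv := ⟨_, mul_mem ht ha⟩
      val_inv := by
        ext <;> simp [glue, hurwitz]
        · linear_combination (algebraMap (𝓞 F) F η / 2) * hF + hη
        · ring
      inv_val := by
        ext <;> simp [glue, hurwitz]
        · linear_combination (algebraMap (𝓞 F) F η / 2) * hF + hη
        · ring }
  have hu2 : ((u ^ 2 : (↥O)ˣ) : O) = (⟨0, -algebraMap (𝓞 F) F (ε : 𝓞 F), 0, 0⟩ : ℍ[F, -1, -1]) := by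
    simp only [u, sq]
    ext <;> simp [glue]
    · ring
    · linear_combination (-1 / 2) * hF
  have hu4 : IsScalarUnit F (u ^ 4) := by
    refine ⟨-ε ^ 2, ?_⟩
    rw [show u ^ 4 = u ^ 2 * u ^ 2 from by rw [← pow_add]]
    simp only [Units.val_mul, Subring.coe_mul, hu2]
    ext <;> simp [QuaternionAlgebra.algebraMap_eq]
    ring
  have h4 := (hφ _).2 hu4
  rw [map_pow] at h4
  have h2 := alternatingGroup_four_pow_two _ h4
  rw [← map_pow] at h2
  obtain ⟨r, hr⟩ := (hφ _).1 h2
  rw [hu2] at hr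
  have := congrArg QuaternionAlgebra.imI hr
  simp [QuaternionAlgebra.algebraMap_eq] at this

/-- If `2ε` is a square then no maximal order containing the Hurwitz quaternions has
reduced unit group `A₄`. -/
theorem not_redUnitIso_of_two_mul_eq_sq {s : F} {d : ℕ} (hd : Squarefree d) (h2 : 2 ≤ d)
    (hs : s ^ 2 = (d : F)) (hgen : Algebra.adjoin ℚ {s} = ⊤) {ε : (𝓞 F)ˣ} {t : F}
    (ht : 2 * algebraMap (𝓞 F) F ε = t ^ 2) {O : Subring ℍ[F, -1, -1]} (hO : IsMaximalOrder F O)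
    (hle : hurwitzOrder F ≤ O) : ¬ RedUnitIso F O (alternatingGroup (Fin 4)) := by
  have htint : IsIntegral ℤ t := by
    apply IsIntegral.of_pow (n := 2) (by norm_num)
    rw [← ht, ← map_ofNat (algebraMap (𝓞 F) F) 2, ← map_mul]
    exact RingOfIntegers.isIntegral_coe _
  obtain ⟨t, rfl⟩ := exists_coe_eq_of_isIntegral htint
  have h : t ^ 2 = 2 * ε := by
    apply RingOfIntegers.coe_injective
    simp only [map_pow, map_mul, map_ofNat, ht]
  have h' : t ^ 2 + t * 0 + 0 ^ 2 = 2 * ε := by rw [← h]; ring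
  obtain ⟨M, hM, -, hdich⟩ := exists_maximalOrder hd h2 hs hgen
  have htw : twist F (glue t 0) = glue t 0 := by ext <;> simp [twist, glue]
  have hMt : glue t 0 ∈ M := by
    rcases hdich _ (isOrder_gluedOrder t 0 ε h') (hurwitzOrder_le_gluedOrder t 0 ε h') with hN | hN
    · exact hN (glue_mem_gluedOrder t 0 ε h')
    · rw [← htw]
      exact hN (glue_mem_gluedOrder t 0 ε h')
  refine not_redUnitIso_of_glue_mem hle h ?_
  rcases hdich O hO.1 hle with hOM | hOM
  · rwa [← hO.2 M hM.1 hOM]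
  · rw [← hO.2 _ (hM.comap (twist F)).1 hOM]
    change twist F (glue t 0) ∈ M
    rwa [htw]

end NotA4

section IsA4

variable {F : Type} [Field F]

/-- Vertices of a regular tetrahedron in the space of pure quaternions. -/
def tetrahedron (F : Type) [Field F] : Fin 4 → ℍ[F, -1, -1] :=
  ![⟨0, 1, 1, 1⟩, ⟨0, 1, -1, -1⟩, ⟨0, -1, 1, -1⟩, ⟨0, -1, -1, 1⟩]

theorem tetrahedron_injective [CharZero F] : Function.Injective (tetrahedron F) := by
  have h1 : (1 : F) ≠ -1 := fun h => by
    have : (2 : F) = 0 := by linear_combination h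
    exact two_ne_zero this
  intro m n h
  fin_cases m <;> fin_cases n <;>
    simp [tetrahedron, QuaternionAlgebra.ext_iff, h1, h1.symm] at h ⊢

/-- Conjugation by `u` permutes the vertices of the tetrahedron through `π`. -/
def ActsBy (u : ℍ[F, -1, -1]) (π : alternatingGroup (Fin 4)) : Prop :=
  ∀ m, u * tetrahedron F m = tetrahedron F (π.1 m) * u

theorem ActsBy.mul {u v : ℍ[F, -1, -1]} {π ρ : alternatingGroup (Fin 4)} (hu : ActsBy u π)
    (hv : ActsBy v ρ) : ActsBy (u * v) (π * ρ) := fun m => by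
  rw [mul_assoc, hv m, ← mul_assoc, hu, mul_assoc]
  rfl

theorem ActsBy.of_mul {u v : ℍ[F, -1, -1]} (hu' : IsUnit u) {π ρ : alternatingGroup (Fin 4)}
    (hu : ActsBy u π) (huv : ActsBy (u * v) ρ) : ActsBy v (π⁻¹ * ρ) := fun m => by
  apply hu'.mul_left_cancel
  have h := hu ((π⁻¹ * ρ).1 m)
  have : π.1 ((π⁻¹ * ρ).1 m) = ρ.1 m := by simp
  rw [this] at h
  rw [← mul_assoc, huv m, ← mul_assoc, ← mul_assoc, h]

theorem ActsBy.unique [CharZero F] {u : ℍ[F, -1, -1]} (hu' : IsUnit u)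
    {π ρ : alternatingGroup (Fin 4)} (hu : ActsBy u π) (hv : ActsBy u ρ) : π = ρ := by
  ext m : 2
  apply tetrahedron_injective (F := F)
  apply hu'.mul_right_cancel
  rw [← hu m, hv m]

/-- The double transposition `(0 1)(2 3)`. -/
def permI : alternatingGroup (Fin 4) :=
  ⟨Equiv.swap 0 1 * Equiv.swap 2 3, Equiv.Perm.mem_alternatingGroup.2 (by decide)⟩

/-- The double transposition `(0 2)(1 3)`. -/
def permJ : alternatingGroup (Fin 4) :=
  ⟨Equiv.swap 0 2 * Equiv.swap 1 3, Equiv.Perm.mem_alternatingGroup.2 (by decide)⟩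

/-- The three-cycle `(1 2 3)`. -/
def permω : alternatingGroup (Fin 4) :=
  ⟨Equiv.swap 1 2 * Equiv.swap 2 3, Equiv.Perm.mem_alternatingGroup.2 (by decide)⟩

theorem exists_eq_permI_permJ_permω : ∀ g : alternatingGroup (Fin 4),
    ∃ a b : Fin 2, ∃ c : Fin 3, g = permI ^ a.1 * permJ ^ b.1 * permω ^ c.1 := by
  decide

theorem actsBy_one (a : F) : ActsBy ⟨a, 0, 0, 0⟩ 1 := by
  intro m
  fin_cases m <;> ext <;> simp [tetrahedron]

theorem actsBy_permI (a : F) : ActsBy ⟨0, a, 0, 0⟩ permI := by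
  have h : permI.1 0 = 1 ∧ permI.1 1 = 0 ∧ permI.1 2 = 3 ∧ permI.1 3 = 2 := by decide
  intro m
  fin_cases m <;> ext <;> simp [tetrahedron, h]

theorem actsBy_permJ (a : F) : ActsBy ⟨0, 0, a, 0⟩ permJ := by
  have h : permJ.1 0 = 2 ∧ permJ.1 1 = 3 ∧ permJ.1 2 = 0 ∧ permJ.1 3 = 1 := by decide
  intro m
  fin_cases m <;> ext <;> simp [tetrahedron, h]

theorem actsBy_permω (a : F) : ActsBy ⟨a, a, a, a⟩ permω := by
  have h : permω.1 0 = 0 ∧ permω.1 1 = 2 ∧ permω.1 2 = 3 ∧ permω.1 3 = 1 := by decide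
  intro m
  fin_cases m <;> ext <;> simp [tetrahedron, h]
  ring

theorem eq_algebraMap_of_actsBy_one [CharZero F] {u : ℍ[F, -1, -1]} (h : ActsBy u 1) :
    u = algebraMap F ℍ[F, -1, -1] u.re := by
  have h0 := QuaternionAlgebra.ext_iff.1 (h 0)
  have h1 := QuaternionAlgebra.ext_iff.1 (h 1)
  simp [tetrahedron] at h0 h1
  have h4 : (4 : F) ≠ 0 := by norm_num
  ext <;> simp [QuaternionAlgebra.algebraMap_eq]
  · apply (mul_eq_zero_iff_left h4).1
    linear_combination h0.2.2 - h1.2.2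
  · apply (mul_eq_zero_iff_left h4).1
    linear_combination -h0.2.2 - h1.2.2
  · apply (mul_eq_zero_iff_left h4).1
    linear_combination h0.2.1 + h1.2.1

end IsA4

section ReducedUnits

variable {F : Type} [Field F] [NumberField F]

/-- The norm of a unit of an order is a unit. -/
theorem IsOrder.exists_unit_norm {O : Subring ℍ[F, -1, -1]} (hO : IsOrder F O) (u : (↥O)ˣ) :
    ∃ η : (𝓞 F)ˣ, algebraMap (𝓞 F) F η = (u : ℍ[F, -1, -1]).re ^ 2 + (u : ℍ[F, -1, -1]).imI ^ 2
      + (u : ℍ[F, -1, -1]).imJ ^ 2 + (u : ℍ[F, -1, -1]).imK ^ 2 := by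
  obtain ⟨n, hn⟩ := (exists_trace_norm (hO.isIntegral u.1.2)).2
  obtain ⟨n', hn'⟩ := (exists_trace_norm (hO.isIntegral u.2.2)).2
  have h : ((u.1 : ℍ[F, -1, -1]) * (u.2 : ℍ[F, -1, -1])) = 1 := congrArg Subtype.val u.val_inv
  change algebraMap (𝓞 F) F n' = (u.2 : ℍ[F, -1, -1]).re ^ 2 + (u.2 : ℍ[F, -1, -1]).imI ^ 2
      + (u.2 : ℍ[F, -1, -1]).imJ ^ 2 + (u.2 : ℍ[F, -1, -1]).imK ^ 2 at hn'
  generalize (u.1 : ℍ[F, -1, -1]) = x at *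
  generalize (u.2 : ℍ[F, -1, -1]) = y at *
  have h' := QuaternionAlgebra.ext_iff.1 h
  simp at h'
  obtain ⟨h1, h2, h3, h4⟩ := h'
  have hnn : n * n' = 1 := by
    apply RingOfIntegers.coe_injective
    simp only [map_mul, map_one, hn, hn']
    linear_combination (x.re * y.re + -(x.imI * y.imI) + -(x.imJ * y.imJ) - x.imK * y.imK + 1) * h1
      + (x.re * y.imI + x.imI * y.re + x.imJ * y.imK - x.imK * y.imJ) * h2
      + (x.re * y.imJ - x.imI * y.imK + x.imJ * y.re + x.imK * y.imI) * h3
      + (x.re * y.imK + x.imI * y.imJ - x.imJ * y.imI + x.imK * y.re) * h4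
  exact ⟨⟨n, n', hnn, by rw [mul_comm, hnn]⟩, hn⟩

theorem exists_int_sign {b c e : ℤ} (h : b ^ 2 + c ^ 2 + e ^ 2 = 4) :
    ((b = 2 ∨ b = -2) ∧ c = 0 ∧ e = 0) ∨ (b = 0 ∧ (c = 2 ∨ c = -2) ∧ e = 0) ∨
      (b = 0 ∧ c = 0 ∧ (e = 2 ∨ e = -2)) := by
  have hb : b ≤ 2 := by nlinarith [sq_nonneg c, sq_nonneg e]
  have hb' : -2 ≤ b := by nlinarith [sq_nonneg c, sq_nonneg e]
  have hc : c ≤ 2 := by nlinarith [sq_nonneg b, sq_nonneg e]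
  have hc' : -2 ≤ c := by nlinarith [sq_nonneg b, sq_nonneg e]
  have he : e ≤ 2 := by nlinarith [sq_nonneg b, sq_nonneg c]
  have he' : -2 ≤ e := by nlinarith [sq_nonneg b, sq_nonneg c]
  interval_cases b <;> interval_cases c <;> interval_cases e <;> simp_all

theorem IsOrder.eq_of_mul_self_eq_neg_one {s : F} {d : ℕ} (hd : Squarefree d) (h6 : 6 ≤ d)
    (hs : s ^ 2 = (d : F)) (hgen : Algebra.adjoin ℚ {s} = ⊤) (σ₀ : F →+* ℝ)
    {O : Subring ℍ[F, -1, -1]} (hO : IsOrder F O) (hle : hurwitzOrder F ≤ O) {y : ℍ[F, -1, -1]}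
    (hy : y ∈ O) (hy2 : y * y = -1) :
    (y = ⟨0, 1, 0, 0⟩ ∨ y = ⟨0, -1, 0, 0⟩) ∨ (y = ⟨0, 0, 1, 0⟩ ∨ y = ⟨0, 0, -1, 0⟩) ∨
      (y = ⟨0, 0, 0, 1⟩ ∨ y = ⟨0, 0, 0, -1⟩) := by
  obtain ⟨A, B, C, D, rfl, -, -⟩ := hO.exists_coords hle hy
  have h := QuaternionAlgebra.ext_iff.1 hy2
  simp at h
  obtain ⟨h1, h2, h3, h4⟩ := h
  have hA : algebraMap (𝓞 F) F A = 0 := by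
    by_contra hA
    have hB : algebraMap (𝓞 F) F B = 0 := by
      apply (mul_eq_zero_iff_left hA).1
      linear_combination 2 * h2
    have hC : algebraMap (𝓞 F) F C = 0 := by
      apply (mul_eq_zero_iff_left hA).1
      linear_combination 2 * h3
    have hD : algebraMap (𝓞 F) F D = 0 := by
      apply (mul_eq_zero_iff_left hA).1
      linear_combination 2 * h4
    rw [hB, hC, hD] at h1
    have := congrArg σ₀ h1
    simp at this
    nlinarith [mul_self_nonneg (σ₀ (algebraMap (𝓞 F) F A) / 2)]
  rw [hA] at h1 ⊢
  have h4 : B ^ 2 + C ^ 2 + D ^ 2 = 4 := by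
    apply RingOfIntegers.coe_injective
    simp only [map_add, map_pow, map_ofNat]
    linear_combination -4 * h1
  obtain ⟨b, c, e, rfl, rfl, rfl⟩ := exists_int_of_sum_sq_eq_four hd h6 hs hgen h4
  rcases exists_int_sign (by exact_mod_cast h4) with
    ⟨rfl | rfl, rfl, rfl⟩ | ⟨rfl, rfl | rfl, rfl⟩ | ⟨rfl, rfl, rfl | rfl⟩ <;>
  simp [QuaternionAlgebra.ext_iff, map_ofNat]

end ReducedUnits

section ReducedUnitsA4

variable {F : Type} [Field F] [NumberField F]

/-- The unit `i` of an order containing the Hurwitz quaternions. -/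
def unitI {O : Subring ℍ[F, -1, -1]} (hle : hurwitzOrder F ≤ O) : (↥O)ˣ where
  val := ⟨_, hle (hurwitz_mem 0 1 0 0)⟩
  inv := ⟨_, hle (hurwitz_mem 0 (-1) 0 0)⟩
  val_inv := by ext <;> simp [hurwitz]
  inv_val := by ext <;> simp [hurwitz]

/-- The unit `j` of an order containing the Hurwitz quaternions. -/
def unitJ {O : Subring ℍ[F, -1, -1]} (hle : hurwitzOrder F ≤ O) : (↥O)ˣ where
  val := ⟨_, hle (hurwitz_mem 0 0 1 0)⟩
  inv := ⟨_, hle (hurwitz_mem 0 0 (-1) 0)⟩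
  val_inv := by ext <;> simp [hurwitz]
  inv_val := by ext <;> simp [hurwitz]

/-- The unit `(1 + i + j + k) / 2` of an order containing the Hurwitz quaternions. -/
def unitω {O : Subring ℍ[F, -1, -1]} (hle : hurwitzOrder F ≤ O) : (↥O)ˣ where
  val := ⟨_, hle (hurwitz_mem 1 0 0 0)⟩
  inv := ⟨_, hle (hurwitz_mem 1 (-1) (-1) (-1))⟩
  val_inv := by ext <;> simp [hurwitz] <;> ring
  inv_val := by ext <;> simp [hurwitz] <;> ring

variable {O : Subring ℍ[F, -1, -1]}

theorem coe_unitI (hle : hurwitzOrder F ≤ O) :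
    ((unitI hle : O) : ℍ[F, -1, -1]) = ⟨0, 1, 0, 0⟩ := by
  ext <;> simp [unitI, hurwitz]

theorem coe_unitJ (hle : hurwitzOrder F ≤ O) :
    ((unitJ hle : O) : ℍ[F, -1, -1]) = ⟨0, 0, 1, 0⟩ := by
  ext <;> simp [unitJ, hurwitz]

theorem coe_unitω (hle : hurwitzOrder F ≤ O) :
    ((unitω hle : O) : ℍ[F, -1, -1]) = ⟨1 / 2, 1 / 2, 1 / 2, 1 / 2⟩ := by
  ext <;> simp [unitω, hurwitz]

omit [NumberField F] in
theorem isUnit_coe (u : (↥O)ˣ) : IsUnit (u : ℍ[F, -1, -1]) := u.isUnit.map O.subtype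

omit [NumberField F] in
theorem exists_conj (u : (↥O)ˣ) {x : ℍ[F, -1, -1]} (hx : x ∈ O) (hx2 : x * x = -1) :
    ∃ y ∈ O, y * y = -1 ∧ (u : ℍ[F, -1, -1]) * x = y * u := by
  have h : ((u⁻¹ : (↥O)ˣ) : ℍ[F, -1, -1]) * (u : ℍ[F, -1, -1]) = 1 := congrArg Subtype.val u.inv_val
  have h' : (u : ℍ[F, -1, -1]) * ((u⁻¹ : (↥O)ˣ) : ℍ[F, -1, -1]) = 1 :=
    congrArg Subtype.val u.val_inv
  refine ⟨u * x * (u⁻¹ : (↥O)ˣ), mul_mem (mul_mem u.1.2 hx) (u⁻¹).1.2, ?_, ?_⟩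
  · calc (u * x * ((u⁻¹ : (↥O)ˣ) : ℍ[F, -1, -1])) * (u * x * ((u⁻¹ : (↥O)ˣ) : ℍ[F, -1, -1]))
        = u * x * (((u⁻¹ : (↥O)ˣ) : ℍ[F, -1, -1]) * u) * x * ((u⁻¹ : (↥O)ˣ) : ℍ[F, -1, -1]) := by
          noncomm_ring
      _ = -1 := by rw [h, mul_one, mul_assoc (u : ℍ[F, -1, -1]) x x, hx2]; simp [h']
  · rw [mul_assoc, h, mul_one]

section

variable {s : F} {d : ℕ} (hd : Squarefree d) (h6 : 6 ≤ d) (hs : s ^ 2 = (d : F))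
  (hgen : Algebra.adjoin ℚ {s} = ⊤) (σ₀ : F →+* ℝ) (hO : IsOrder F O) (hle : hurwitzOrder F ≤ O)
  (h2 : ∀ (η : (𝓞 F)ˣ) (c : F), 2 * c ^ 2 ≠ algebraMap (𝓞 F) F ↑η)
include hd h6 hs hgen σ₀ hO hle h2

theorem exists_actsBy_of_commute (u : (↥O)ˣ)
    (hu : (u : ℍ[F, -1, -1]) * ⟨0, 1, 0, 0⟩ = ⟨0, 1, 0, 0⟩ * u) :
    ∃ π, ActsBy (u : ℍ[F, -1, -1]) π := by
  have hj : (⟨0, 0, 1, 0⟩ : ℍ[F, -1, -1]) ∈ O := by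
    rw [← coe_unitJ hle]; exact (unitJ hle).1.2
  obtain ⟨z, hz, hz2, huz⟩ := exists_conj u hj (by ext <;> simp)
  obtain ⟨η, hη⟩ := hO.exists_unit_norm u
  have hη0 : algebraMap (𝓞 F) F η ≠ 0 := by
    simp
  have h := hO.eq_of_mul_self_eq_neg_one hd h6 hs hgen σ₀ hle hz hz2
  generalize (u : ℍ[F, -1, -1]) = x at *
  obtain ⟨a, b, c, e⟩ := x
  have h22 : (2 : F) ≠ 0 := two_ne_zero
  have hc0 : c = 0 := by
    have := congrArg QuaternionAlgebra.imK hu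
    simp at this
    apply (mul_eq_zero_iff_left h22).1
    linear_combination -this
  have he0 : e = 0 := by
    have := congrArg QuaternionAlgebra.imJ hu
    simp at this
    apply (mul_eq_zero_iff_left h22).1
    linear_combination this
  subst hc0 he0
  rcases h with (rfl | rfl) | (rfl | rfl) | (rfl | rfl) <;>
    simp [QuaternionAlgebra.ext_iff] at huz
  · obtain ⟨rfl, -, rfl, -⟩ := huz
    simp at hη
  · obtain ⟨rfl, rfl, -⟩ := huz
    simp at hη
  · obtain rfl : b = 0 := by
      apply (mul_eq_zero_iff_left h22).1
      linear_combination huz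
    exact ⟨_, actsBy_one a⟩
  · obtain rfl : a = 0 := by
      apply (mul_eq_zero_iff_left h22).1
      linear_combination huz
    exact ⟨_, actsBy_permI b⟩
  · refine absurd ?_ (h2 η a)
    rw [hη]
    simp [huz.1]
    ring
  · refine absurd ?_ (h2 η a)
    rw [hη]
    simp [huz.1]
    ring

theorem exists_actsBy (u : (↥O)ˣ) : ∃ π, ActsBy (u : ℍ[F, -1, -1]) π := by
  have hi : (⟨0, 1, 0, 0⟩ : ℍ[F, -1, -1]) ∈ O := by
    rw [← coe_unitI hle]; exact (unitI hle).1.2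
  obtain ⟨y, hy, hy2, huy⟩ := exists_conj u hi (by ext <;> simp)
  have key : ∀ v : (↥O)ˣ, (∃ π, ActsBy (v : ℍ[F, -1, -1]) π) →
      (v : ℍ[F, -1, -1]) * y = ⟨0, 1, 0, 0⟩ * v → ∃ π, ActsBy (u : ℍ[F, -1, -1]) π := by
    rintro v ⟨π, hπ⟩ hv
    obtain ⟨ρ, hρ⟩ := exists_actsBy_of_commute hd h6 hs hgen σ₀ hO hle h2 (v * u) (by
      push_cast
      rw [mul_assoc, huy, ← mul_assoc, hv, mul_assoc])
    exact ⟨_, ActsBy.of_mul (isUnit_coe v) hπ (by simpa using hρ)⟩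
  have hI := coe_unitI hle
  have hJ := coe_unitJ hle
  have hω := coe_unitω hle
  have aI : ActsBy (unitI hle : ℍ[F, -1, -1]) permI := by rw [hI]; exact actsBy_permI _
  have aJ : ActsBy (unitJ hle : ℍ[F, -1, -1]) permJ := by rw [hJ]; exact actsBy_permJ _
  have aω : ActsBy (unitω hle : ℍ[F, -1, -1]) permω := by rw [hω]; exact actsBy_permω _
  rcases hO.eq_of_mul_self_eq_neg_one hd h6 hs hgen σ₀ hle hy hy2 with
    (rfl | rfl) | (rfl | rfl) | (rfl | rfl)
  · exact key 1 ⟨1, fun m => by simp⟩ (by simp)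
  · exact key (unitJ hle) ⟨_, aJ⟩ (by rw [hJ]; ext <;> simp)
  · exact key (unitω hle * unitω hle) ⟨_, by push_cast; exact aω.mul aω⟩
      (by push_cast; rw [hω]; ext <;> simp <;> norm_num)
  · exact key (unitω hle * unitω hle * unitI hle) ⟨_, by push_cast; exact (aω.mul aω).mul aI⟩
      (by push_cast; rw [hω, hI]; ext <;> simp)
  · exact key (unitω hle) ⟨_, aω⟩ (by rw [hω]; ext <;> simp)
  · exact key (unitω hle * unitI hle) ⟨_, by push_cast; exact aω.mul aI⟩
      (by push_cast; rw [hω, hI]; ext <;> simp)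

theorem redUnitIso_alternatingGroup : RedUnitIso F O (alternatingGroup (Fin 4)) := by
  choose f hf using exists_actsBy hd h6 hs hgen σ₀ hO hle h2
  have huniq : ∀ (u : (↥O)ˣ) π, ActsBy (u : ℍ[F, -1, -1]) π → f u = π :=
    fun u π h => (hf u).unique (isUnit_coe u) h
  refine ⟨MonoidHom.mk' f fun u v => huniq _ _ (by simpa using (hf u).mul (hf v)), ?_, fun u => ?_⟩
  · intro g
    obtain ⟨a, b, c, rfl⟩ := exists_eq_permI_permJ_permω g
    have aI : f (unitI hle) = permI := huniq _ _ (by rw [coe_unitI]; exact actsBy_permI _)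
    have aJ : f (unitJ hle) = permJ := huniq _ _ (by rw [coe_unitJ]; exact actsBy_permJ _)
    have aω : f (unitω hle) = permω := huniq _ _ (by rw [coe_unitω]; exact actsBy_permω _)
    refine ⟨unitI hle ^ a.1 * unitJ hle ^ b.1 * unitω hle ^ c.1, ?_⟩
    rw [map_mul, map_mul, map_pow, map_pow, map_pow, MonoidHom.mk'_apply, aI, aJ, aω]
  · rw [MonoidHom.mk'_apply]
    constructor
    · intro hu
      have h1 := hf u
      rw [hu] at h1
      have hre := eq_algebraMap_of_actsBy_one h1
      obtain ⟨η, hη⟩ := hO.exists_unit_norm u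
      have hint : IsIntegral ℤ (u : ℍ[F, -1, -1]).re := by
        rw [← isIntegral_algebraMap_iff (FaithfulSMul.algebraMap_injective F ℍ[F, -1, -1]), ← hre]
        exact hO.isIntegral u.1.2
      obtain ⟨r, hr⟩ := exists_coe_eq_of_isIntegral hint
      have hr2 : r ^ 2 = η := by
        apply RingOfIntegers.coe_injective
        rw [hη, hre, map_pow, hr]
        simp [QuaternionAlgebra.algebraMap_eq]
      have hru : IsUnit r := (isUnit_pow_iff two_ne_zero).1 (hr2 ▸ η.isUnit)
      exact ⟨hru.unit, by rw [hre, ← hr]; rfl⟩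
    · rintro ⟨r, hr⟩
      refine huniq u 1 ?_
      rw [hr, QuaternionAlgebra.algebraMap_eq]
      exact actsBy_one _

end

end ReducedUnitsA4

section QuaternionRelations

variable {F H : Type} [Field F] [Ring H] [Algebra F H]

theorem quaternion_relations [NoZeroDivisors H] [Nontrivial H] {i j k w : H} {a s t : F}
    (hw : w ≠ 0) (hi : i * i = a • 1) (hwi : w * i = j * w) (hwj : w * j = k * w)
    (hk : k = s • (i * j)) (hij : i * j = t • (j * i)) (hns : ∀ r : F, i ≠ algebraMap F H r) :
    (s • i) * (s • i) = -1 ∧ (s • j) * (s • j) = -1 ∧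
      (s • j) * (s • i) = -((s • i) * (s • j)) ∧ w * (s • i) = (s • j) * w ∧
      w * (s • j) = (s • i) * (s • j) * w := by
  have hi0 : i ≠ 0 := fun h => hns 0 (by simp [h])
  have hj : j * j = a • 1 := by
    apply mul_right_cancel₀ hw
    rw [mul_assoc, ← hwi, ← mul_assoc, ← hwi, mul_assoc, hi]; simp
  have hkk : k * k = a • 1 := by
    apply mul_right_cancel₀ hw
    rw [mul_assoc, ← hwj, ← mul_assoc, ← hwj, mul_assoc, hj]; simp
  have ha : a ≠ 0 := fun h => mul_ne_zero hi0 hi0 (by rw [hi, h, zero_smul])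
  have ht : t ^ 2 = 1 := by
    have h1 : i * j * j = a • i := by rw [mul_assoc, hj]; simp
    have h2 : i * j * j = (t ^ 2 * a) • i := by
      rw [hij, smul_mul_assoc, mul_assoc, hij, mul_smul_comm, ← mul_assoc, hj, smul_smul, ← sq]
      simp [smul_smul]
    have h3 : (t ^ 2 * a - a) • i = 0 := by rw [sub_smul, ← h1, ← h2, sub_self]
    have h4 := (smul_eq_zero.1 h3).resolve_right hi0
    apply mul_right_cancel₀ ha
    linear_combination h4
  have hji : j * i = t • (i * j) := by rw [hij, smul_smul, ← sq, ht, one_smul]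
  have hsa : s ^ 2 * t * a = 1 := by
    have h1 : k * k = (s ^ 2 * t * a * a) • (1 : H) := by
      rw [hk, smul_mul_smul_comm, mul_assoc i, ← mul_assoc j, hji, smul_mul_assoc, mul_smul_comm,
        mul_assoc i j j, hj, mul_smul_comm, mul_one, mul_smul_comm, hi]
      simp only [smul_smul]
      congr 1
      ring
    have h3 : (s ^ 2 * t * a * a - a) • (1 : H) = 0 := by rw [sub_smul, ← h1, ← hkk, sub_self]
    have h4 := (smul_eq_zero.1 h3).resolve_right one_ne_zero
    apply mul_right_cancel₀ ha
    linear_combination h4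
  have hsi : (s • i) * (s • i) = (s ^ 2 * a) • (1 : H) := by
    rw [smul_mul_smul_comm, hi, smul_smul, sq]
  have hsj : (s • j) * (s • j) = (s ^ 2 * a) • (1 : H) := by
    rw [smul_mul_smul_comm, hj, smul_smul, sq]
  rcases mul_self_eq_one_iff.1 ((sq t).symm.trans ht) with rfl | rfl
  · exfalso
    have hs : s ≠ 0 := by rintro rfl; simp at hsa
    have h1 : (s • i - 1) * (s • i + 1) = 0 := by
      have h : ∀ x : H, (x - 1) * (x + 1) = x * x - 1 := fun x => by noncomm_ring
      rw [h, hsi, ← mul_one (s ^ 2), hsa, one_smul, sub_self]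
    rcases mul_eq_zero.1 h1 with h | h
    · apply hns s⁻¹
      rw [Algebra.algebraMap_eq_smul_one, ← sub_eq_zero.1 h, smul_smul, inv_mul_cancel₀ hs,
        one_smul]
    · apply hns (-s⁻¹)
      rw [Algebra.algebraMap_eq_smul_one, neg_smul, ← smul_neg, ← eq_neg_of_add_eq_zero_left h,
        smul_smul, inv_mul_cancel₀ hs, one_smul]
  · have hsa' : s ^ 2 * a = -1 := by linear_combination -hsa
    refine ⟨by rw [hsi, hsa']; simp, by rw [hsj, hsa']; simp, ?_, ?_, ?_⟩
    · rw [smul_mul_smul_comm, smul_mul_smul_comm, hji]; simp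
    · rw [mul_smul_comm, hwi, smul_mul_assoc]
    · rw [mul_smul_comm, hwj, hk, smul_mul_smul_comm, smul_mul_assoc, smul_mul_assoc, smul_smul]

theorem norm_eq_zero_iff (σ₀ : F →+* ℝ) {x : ℍ[F, -1, -1]} :
    x.re ^ 2 + x.imI ^ 2 + x.imJ ^ 2 + x.imK ^ 2 = 0 ↔ x = 0 := by
  refine ⟨fun h => ?_, fun h => by simp [h]⟩
  have h' := congrArg σ₀ h
  simp only [map_add, map_pow, map_zero] at h'
  have key : ∀ y : F, σ₀ y ^ 2 ≤ 0 → y = 0 := fun y hy => by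
    have := pow_eq_zero_iff two_ne_zero |>.1 (le_antisymm hy (sq_nonneg _))
    exact (map_eq_zero σ₀).1 this
  have h1 := sq_nonneg (σ₀ x.re)
  have h2 := sq_nonneg (σ₀ x.imI)
  have h3 := sq_nonneg (σ₀ x.imJ)
  have h4 := sq_nonneg (σ₀ x.imK)
  ext
  · exact key _ (by linarith)
  · exact key _ (by linarith)
  · exact key _ (by linarith)
  · exact key _ (by linarith)

theorem exists_algEquiv_of_relations (σ₀ : F →+* ℝ) [Nontrivial H] (hquat : IsQuatAlg F H)
    {I J : H} (hI : I * I = -1) (hJ : J * J = -1) (hJI : J * I = -(I * J)) :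
    ∃ e : H ≃ₐ[F] ℍ[F, -1, -1], e I = ⟨0, 1, 0, 0⟩ ∧ e J = ⟨0, 0, 1, 0⟩ := by
  obtain ⟨a, b, -, -, ⟨f⟩⟩ := hquat
  let B : QuaternionAlgebra.Basis H (-1 : F) 0 (-1) :=
    { i := I
      j := J
      k := I * J
      i_mul_i := by simp [hI]
      j_mul_j := by simp [hJ]
      i_mul_j := rfl
      j_mul_i := by simp [hJI] }
  have hinj : Function.Injective B.liftHom := by
    rw [injective_iff_map_eq_zero]
    intro x hx
    rw [← norm_eq_zero_iff σ₀]
    have h1 : B.liftHom (star x * x) = 0 := by rw [map_mul, hx, mul_zero]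
    have h2 : star x * x = algebraMap F ℍ[F, -1, -1]
        (x.re ^ 2 + x.imI ^ 2 + x.imJ ^ 2 + x.imK ^ 2) := by
      ext <;> simp [QuaternionAlgebra.algebraMap_eq] <;> ring
    rw [h2, AlgHom.commutes] at h1
    exact (map_eq_zero_iff _ (FaithfulSMul.algebraMap_injective F H)).1 h1
  have hfin : Module.Finite F H := Module.Finite.equiv f.symm.toLinearEquiv
  have hrank : Module.finrank F ℍ[F, -1, -1] = Module.finrank F H := by
    rw [f.toLinearEquiv.finrank_eq, QuaternionAlgebra.finrank_eq_four,
      QuaternionAlgebra.finrank_eq_four]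
  have hbij : Function.Bijective B.liftHom := ⟨hinj,
    (LinearMap.injective_iff_surjective_of_finrank_eq_finrank hrank
      (f := B.liftHom.toLinearMap)).1 hinj⟩
  refine ⟨(AlgEquiv.ofBijective _ hbij).symm, ?_, ?_⟩
  · rw [AlgEquiv.symm_apply_eq]
    simp [B, QuaternionAlgebra.Basis.lift]
  · rw [AlgEquiv.symm_apply_eq]
    simp [B, QuaternionAlgebra.Basis.lift]

theorem noZeroDivisors_of_totallyDefinite (σ₀ : F →+* ℝ) (hdef : TotallyDefinite F H) :
    NoZeroDivisors H := by
  let : Algebra F ℝ := σ₀.toAlgebra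
  have hinj : Function.Injective
      (Algebra.TensorProduct.includeRight : H →ₐ[F] TensorProduct F ℝ H) :=
    Algebra.TensorProduct.includeRight_injective (FaithfulSMul.algebraMap_injective F ℝ)
  refine ⟨fun {x y} hxy => ?_⟩
  by_contra! h
  have hu := hdef σ₀ (Algebra.TensorProduct.includeRight x)
    ((map_ne_zero_iff _ hinj).2 h.1)
  apply h.2
  apply hinj
  apply hu.mul_left_cancel
  rw [← map_mul, hxy, map_zero, mul_zero]

end QuaternionRelations

section Recognition

variable {F H : Type} [Field F] [NumberField F] [Ring H] [Algebra F H]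

theorem permI_permω_relations : permI ≠ 1 ∧ permI * permI = 1 ∧ permω * (permω * permω) = 1 ∧
    permω * (permω * permI * permω⁻¹) * permω⁻¹ = permI * (permω * permI * permω⁻¹) ∧
    permI * (permω * permI * permω⁻¹) = permω * permI * permω⁻¹ * permI := by
  decide

theorem eq_smul_of_relations {W : ℍ[F, -1, -1]} (hi : W * ⟨0, 1, 0, 0⟩ = ⟨0, 0, 1, 0⟩ * W)
    (hj : W * ⟨0, 0, 1, 0⟩ = ⟨0, 0, 0, 1⟩ * W) : W = (2 * W.re) • hurwitz 1 0 0 0 := by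
  obtain ⟨a, b, c, d⟩ := W
  have h1 := QuaternionAlgebra.ext_iff.1 hi
  have h2 := QuaternionAlgebra.ext_iff.1 hj
  simp at h1 h2
  obtain ⟨rfl, rfl, -⟩ := h1
  obtain ⟨rfl, -⟩ := h2
  ext <;> simp [hurwitz] <;> field_simp

theorem hurwitz_one_cube :
    (hurwitz 1 0 0 0 * (hurwitz 1 0 0 0 * hurwitz 1 0 0 0) : ℍ[F, -1, -1]) = -1 := by
  ext <;> simp [hurwitz] <;> ring

/-- An order in a totally definite quaternion algebra with reduced unit group `A₄` contains a copy
of the Hurwitz quaternions. -/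
theorem exists_algEquiv_hurwitzOrder_le (σ₀ : F →+* ℝ) (hquat : IsQuatAlg F H)
    (hdef : TotallyDefinite F H) {O : Subring H} (hO : IsOrder F O)
    (hred : RedUnitIso F O (alternatingGroup (Fin 4))) :
    ∃ e : H ≃ₐ[F] ℍ[F, -1, -1], hurwitzOrder F ≤ O.comap (e.symm : ℍ[F, -1, -1] →+* H) := by
  obtain ⟨φ, hφ, hker⟩ := hred
  have hnt : Nontrivial H := by
    obtain ⟨a, b, -, -, ⟨f⟩⟩ := hquat
    exact f.toEquiv.nontrivial
  have hnz : NoZeroDivisors H := noZeroDivisors_of_totallyDefinite σ₀ hdef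
  have hsc : ∀ u v : (↥O)ˣ, φ u = φ v →
      ∃ r : (𝓞 F)ˣ, (u : H) = algebraMap (𝓞 F) F r • (v : H) := by
    intro u v huv
    obtain ⟨r, hr⟩ := (hker (u * v⁻¹)).1 (by rw [map_mul, map_inv, huv, mul_inv_cancel])
    refine ⟨r, ?_⟩
    rw [Algebra.smul_def, ← hr, ← Subring.coe_mul, ← Units.val_mul, inv_mul_cancel_right]
  have hsmul : ∀ (r : 𝓞 F) {x : H}, x ∈ O → algebraMap (𝓞 F) F r • x ∈ O := by
    intro r x hx
    rw [Algebra.smul_def]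
    exact mul_mem (hO.1 ⟨r, rfl⟩) hx
  obtain ⟨hne, hI2, hω3, hk, hij⟩ := permI_permω_relations
  obtain ⟨i, hi⟩ := hφ permI
  obtain ⟨w, hw⟩ := hφ permω
  obtain ⟨a, ha⟩ := hsc (i * i) 1 (by rw [map_mul, hi, hI2, map_one])
  obtain ⟨s, hs⟩ := hsc (w * (w * i * w⁻¹) * w⁻¹) (i * (w * i * w⁻¹)) (by
    simp only [map_mul, map_inv, hi, hw, hk])
  obtain ⟨t, ht⟩ := hsc (i * (w * i * w⁻¹)) (w * i * w⁻¹ * i) (by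
    simp only [map_mul, map_inv, hi, hw, hij])
  obtain ⟨r, hr⟩ := hsc (w * (w * w)) 1 (by rw [map_mul, map_mul, hw, hω3, map_one])
  have hw0 : (w : H) ≠ 0 := (w.isUnit.map O.subtype).ne_zero
  have hcancel : ∀ x : (↥O)ˣ, (w : H) * x = ((w * x * w⁻¹ : (↥O)ˣ) : H) * w := by
    intro x
    rw [← Subring.coe_mul, ← Subring.coe_mul, ← Units.val_mul, ← Units.val_mul,
      inv_mul_cancel_right]
  have hns : ∀ r : F, (i : H) ≠ algebraMap F H r := by
    intro r hr
    apply hne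
    rw [← hi, hker]
    have hint : IsIntegral ℤ r := by
      rw [← isIntegral_algebraMap_iff (FaithfulSMul.algebraMap_injective F H), ← hr]
      exact hO.isIntegral i.1.2
    obtain ⟨r, rfl⟩ := exists_coe_eq_of_isIntegral hint
    have hr2 : r ^ 2 = a := by
      apply RingOfIntegers.coe_injective
      apply FaithfulSMul.algebraMap_injective F H
      rw [map_pow, map_pow, ← hr, sq, Algebra.algebraMap_eq_smul_one]
      simpa using ha
    have hru : IsUnit r := (isUnit_pow_iff two_ne_zero).1 (hr2 ▸ a.isUnit)
    exact ⟨hru.unit, hr⟩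
  obtain ⟨h1, h2, h3, h4, h5⟩ := quaternion_relations hw0
    (a := algebraMap (𝓞 F) F a) (by simpa using ha) (hcancel i) (hcancel _)
    (s := algebraMap (𝓞 F) F s) (by simpa only [Units.val_mul, Subring.coe_mul] using hs)
    (t := algebraMap (𝓞 F) F t) (by simpa only [Units.val_mul, Subring.coe_mul] using ht) hns
  obtain ⟨e, heI, heJ⟩ := exists_algEquiv_of_relations σ₀ hquat h1 h2 h3
  refine ⟨e, (hO.comap e.symm).hurwitzOrder_le ?_ ?_ ?_⟩
  · change e.symm _ ∈ O
    have : hurwitz 0 1 0 0 = (⟨0, 1, 0, 0⟩ : ℍ[F, -1, -1]) := by ext <;> simp [hurwitz]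
    rw [this, ← heI, e.symm_apply_apply]
    exact hsmul s i.1.2
  · change e.symm _ ∈ O
    have : hurwitz 0 0 1 0 = (⟨0, 0, 1, 0⟩ : ℍ[F, -1, -1]) := by ext <;> simp [hurwitz]
    rw [this, ← heJ, e.symm_apply_apply]
    exact hsmul s (w * i * w⁻¹).1.2
  · change e.symm _ ∈ O
    have hW := eq_smul_of_relations (W := e w) (by rw [← heI, ← heJ, ← map_mul, h4, map_mul]) (by
      have hk : (⟨0, 0, 0, 1⟩ : ℍ[F, -1, -1]) = ⟨0, 1, 0, 0⟩ * ⟨0, 0, 1, 0⟩ := by ext <;> simp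
      rw [hk, ← heI, ← heJ, ← map_mul, h5, map_mul, map_mul])
    set c := 2 * (e w).re
    have hc3 : -c ^ 3 = algebraMap (𝓞 F) F r := by
      have h := congrArg e hr
      have h' : e (w : H) * (e (w : H) * e (w : H)) = algebraMap (𝓞 F) F r • 1 := by
        simpa only [Units.val_mul, Subring.coe_mul, Units.val_one, Subring.coe_one, map_mul,
          map_smul, map_one] using h
      rw [hW, smul_mul_smul_comm, smul_mul_smul_comm, hurwitz_one_cube] at h'
      have := congrArg QuaternionAlgebra.re h'
      simp only [QuaternionAlgebra.re_smul, QuaternionAlgebra.re_neg, QuaternionAlgebra.re_one,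
        smul_eq_mul] at this
      linear_combination this
    have hcint : IsIntegral ℤ c := by
      apply IsIntegral.of_pow (n := 3) (by norm_num)
      rw [← neg_neg (c ^ 3), hc3]
      exact (RingOfIntegers.isIntegral_coe _).neg
    obtain ⟨γ, hγ⟩ := exists_coe_eq_of_isIntegral hcint
    have hγ3 : -γ ^ 3 = r := by
      apply RingOfIntegers.coe_injective
      rw [map_neg, map_pow, hγ, hc3]
    have hγu : IsUnit γ := (isUnit_pow_iff three_ne_zero).1 (neg_neg (γ ^ 3) ▸ hγ3 ▸ r.isUnit.neg)
    obtain ⟨δ, hδ⟩ := hγu.exists_left_inv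
    have hδ' : algebraMap (𝓞 F) F δ * c = 1 := by rw [← hγ, ← map_mul, hδ, map_one]
    have : hurwitz 1 0 0 0 = algebraMap (𝓞 F) F δ • e (w : H) := by
      rw [hW, smul_smul, hδ', one_smul]
    rw [this, map_smul, e.symm_apply_apply]
    exact hsmul δ w.1.2

end Recognition

section SkolemNoether

variable {F : Type} [Field F]

/-- The average `c + i' c i⁻¹ + j' c j⁻¹ + k' c k⁻¹`, which intertwines two pairs of anticommuting
square roots of `-1`. -/
def intertwiner {R : Type*} [Ring R] (i j i' j' c : R) : R :=
  c - i' * c * i - j' * c * j - i' * j' * c * (i * j)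

theorem intertwiner_mul {R : Type*} [Ring R] {i j i' j' : R} (hi : i * i = -1) (hj : j * j = -1)
    (hji : j * i = -(i * j)) (hi' : i' * i' = -1) (hj' : j' * j' = -1) (hji' : j' * i' = -(i' * j'))
    (c : R) : intertwiner i j i' j' c * i = i' * intertwiner i j i' j' c ∧
      intertwiner i j i' j' c * j = j' * intertwiner i j i' j' c := by
  have h1 (z : R) : i * (i * z) = -z := by rw [← mul_assoc, hi, neg_one_mul]
  have h2 (z : R) : i' * (i' * z) = -z := by rw [← mul_assoc, hi', neg_one_mul]
  have h3 (z : R) : j' * (j' * z) = -z := by rw [← mul_assoc, hj', neg_one_mul]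
  have h4 (z : R) : j' * (i' * z) = -(i' * (j' * z)) := by
    rw [← mul_assoc, hji', neg_mul, mul_assoc]
  constructor <;>
    simp only [intertwiner, mul_sub, sub_mul, mul_assoc, h1, h2, h3, h4, hi, hj, hji, mul_neg,
      neg_neg, mul_one] <;>
    abel

theorem exists_intertwiner_ne_zero {R : Type*} [Ring R] [Nontrivial R] {i j i' j' : R}
    (hi : i * i = -1) (hj : j * j = -1) (hji : j * i = -(i * j))
    (h2 : ∀ z : R, z + z = 0 → z = 0) : ∃ c, intertwiner i j i' j' c ≠ 0 := by
  by_contra! h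
  have h1 (z : R) : i * (i * z) = -z := by rw [← mul_assoc, hi, neg_one_mul]
  have h3 (z : R) : j * (j * z) = -z := by rw [← mul_assoc, hj, neg_one_mul]
  have h4 (z : R) : j * (i * z) = -(i * (j * z)) := by
    rw [← mul_assoc, hji, neg_mul, mul_assoc]
  have key {p q : R} (hq : q * q = -1)
      (hpq : intertwiner i j i' j' 1 - intertwiner i j i' j' q * q = 1 - p * q + (1 - p * q)) :
      p = -q := by
    rw [h, h, zero_mul, sub_zero, eq_comm] at hpq
    have hpq' := congrArg (· * q) (h2 _ hpq)
    simp only [sub_mul, one_mul, mul_assoc, hq, zero_mul, mul_neg, mul_one, sub_neg_eq_add]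
      at hpq'
    rw [eq_neg_iff_add_eq_zero, add_comm, hpq']
  have hI : i' = -i := key hi (by
    simp only [intertwiner, sub_mul, mul_assoc, h1, hi, hji, mul_neg, neg_neg, mul_one,
      neg_mul]
    abel)
  have hJ : j' = -j := key hj (by
    simp only [intertwiner, sub_mul, mul_assoc, h4, hj, hji, mul_neg, neg_neg, mul_one,
      neg_mul]
    abel)
  have hK : i' * j' = -(i * j) := key
    (by simp only [mul_assoc, h4, hj, mul_neg, mul_one, neg_neg, hi]) (by
    simp only [intertwiner, sub_mul, mul_assoc, h1, h4, hi, hj, hji, mul_neg, neg_neg, mul_one,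
      neg_mul]
    abel)
  rw [hI, hJ, neg_mul_neg, eq_neg_iff_add_eq_zero] at hK
  have hk := congrArg (i * · * j) (h2 _ hK)
  simp [h1, hj] at hk

theorem isUnit_of_ne_zero (σ₀ : F →+* ℝ) {x : ℍ[F, -1, -1]} (hx : x ≠ 0) : IsUnit x := by
  set n := x.re ^ 2 + x.imI ^ 2 + x.imJ ^ 2 + x.imK ^ 2 with hn
  have hn0 : n ≠ 0 := mt (norm_eq_zero_iff σ₀).1 hx
  have h1 : x * star x = n • 1 := by ext <;> simp [hn] <;> ring
  have h2 : star x * x = n • 1 := by ext <;> simp [hn] <;> ring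
  refine isUnit_iff_exists.2 ⟨n⁻¹ • star x, ?_, ?_⟩
  · rw [mul_smul_comm, h1, smul_smul, inv_mul_cancel₀ hn0, one_smul]
  · rw [smul_mul_assoc, h2, smul_smul, inv_mul_cancel₀ hn0, one_smul]

/-- Skolem–Noether for the Hamilton quaternions over a formally real field. -/
theorem exists_conj_of_algEquiv (σ₀ : F →+* ℝ) (f : ℍ[F, -1, -1] ≃ₐ[F] ℍ[F, -1, -1]) :
    ∃ x : ℍ[F, -1, -1]ˣ, ∀ y, f y = x * y * ↑x⁻¹ := by
  set i : ℍ[F, -1, -1] := ⟨0, 1, 0, 0⟩ with hi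
  set j : ℍ[F, -1, -1] := ⟨0, 0, 1, 0⟩ with hj
  have hii : i * i = -1 := by ext <;> simp [hi]
  have hjj : j * j = -1 := by ext <;> simp [hj]
  have hji : j * i = -(i * j) := by ext <;> simp [hi, hj]
  have hii' : f i * f i = -1 := by rw [← map_mul, hii, map_neg, map_one]
  have hjj' : f j * f j = -1 := by rw [← map_mul, hjj, map_neg, map_one]
  have hji' : f j * f i = -(f i * f j) := by rw [← map_mul, hji, map_neg, map_mul]
  have h20 : (2 : F) ≠ 0 := fun h => two_ne_zero (α := ℝ) (by rw [← map_ofNat σ₀, h, map_zero])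
  obtain ⟨c, hc⟩ := exists_intertwiner_ne_zero (i' := f i) (j' := f j) hii hjj hji (fun z hz => by
    rw [← two_smul F] at hz
    exact (smul_eq_zero.1 hz).resolve_left h20)
  obtain ⟨hxi, hxj⟩ := intertwiner_mul hii hjj hji hii' hjj' hji' c
  obtain ⟨x, hx⟩ := isUnit_of_ne_zero σ₀ hc
  rw [← hx] at hxi hxj
  refine ⟨x, fun y => ?_⟩
  rw [Units.eq_mul_inv_iff_mul_eq]
  have hy : y = y.re • 1 + y.imI • i + y.imJ • j + y.imK • (i * j) := by
    ext <;> simp [hi, hj]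
  have hk : f (i * j) * x = x * (i * j) := by
    rw [map_mul, mul_assoc, ← hxj, ← mul_assoc, ← hxi, mul_assoc]
  rw [hy]
  simp only [map_add, map_smul, map_one, add_mul, mul_add, smul_mul_assoc, mul_smul_comm, hk,
    ← hxi, ← hxj, one_mul, mul_one]

end SkolemNoether

section Conjugacy

variable {F H : Type} [Field F] [Ring H] [Algebra F H]

theorem conjRel_comap (σ₀ : F →+* ℝ) (M : Subring ℍ[F, -1, -1]) (e e' : H ≃ₐ[F] ℍ[F, -1, -1]) :
    ConjRel (M.comap (e : H →+* ℍ[F, -1, -1])) (M.comap (e' : H →+* ℍ[F, -1, -1])) := by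
  obtain ⟨x, hx⟩ := exists_conj_of_algEquiv σ₀ (e'.symm.trans e)
  refine ⟨Units.map (e'.symm : ℍ[F, -1, -1] →* H) x, fun y => ?_⟩
  have := hx (e' y)
  simp at this
  change e y ∈ M ↔ e' _ ∈ M
  rw [this]
  simp

end Conjugacy

/-- **Refined type number for `A₄`** -/
theorem typeNum_A4
    (d : ℕ) (hd6 : 6 ≤ d) (hdsf : Squarefree d)
    (sqrtd : F) (hsqrtd : sqrtd ^ 2 = (d : F))
    (hgen : Algebra.adjoin ℚ {sqrtd} = ⊤)
    (σ₀ : F →+* ℝ) (hσ₀ : 0 < σ₀ sqrtd)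
    -- `ε` is the fundamental unit of `F`: the smallest unit greater than `1`
    (ε : (𝓞 F)ˣ) (hε : 1 < σ₀ (algebraMap (𝓞 F) F ↑ε))
    (hεfund : ∀ u : (𝓞 F)ˣ, 1 < σ₀ (algebraMap (𝓞 F) F ↑u) →
      σ₀ (algebraMap (𝓞 F) F ↑ε) ≤ σ₀ (algebraMap (𝓞 F) F ↑u))
    (H : Type) [Ring H] [Algebra F H]
    (hquat : IsQuatAlg F H) (hdef : TotallyDefinite F H) :
    (Nonempty (H ≃ₐ[F] ℍ[F, -1, -1]) ∧
        ¬(∃ t : F, 2 * algebraMap (𝓞 F) F ↑ε = t ^ 2) →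
      typeNum F H ↥(alternatingGroup (Fin 4)) = 1) ∧
    (¬(Nonempty (H ≃ₐ[F] ℍ[F, -1, -1]) ∧
        ¬(∃ t : F, 2 * algebraMap (𝓞 F) F ↑ε = t ^ 2)) →
      typeNum F H ↥(alternatingGroup (Fin 4)) = 0) := by
  have h2 : 2 ≤ d := by omega
  have hrec : ∀ O : Subring H, IsMaximalOrder F O ∧ RedUnitIso F O (alternatingGroup (Fin 4)) →
      ∃ e : H ≃ₐ[F] ℍ[F, -1, -1], hurwitzOrder F ≤ O.comap (e.symm : ℍ[F, -1, -1] →+* H) :=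
    fun O hO => exists_algEquiv_hurwitzOrder_le σ₀ hquat hdef hO.1.1 hO.2
  refine ⟨fun ⟨⟨e₀⟩, hsq⟩ => ?_, fun h => ?_⟩
  · obtain ⟨M, hM, hle, hmax⟩ := exists_maximalOrder hdsf h2 hsqrtd hgen
    have hMA := redUnitIso_alternatingGroup hdsf hd6 hsqrtd hgen σ₀ hM.1 hle fun η c hc =>
      hsq (two_mul_fundamentalUnit_eq_sq hdsf hd6 hsqrtd hgen σ₀ ε hε hεfund η c hc)
    have hall : ∀ O : Subring H,
        IsMaximalOrder F O ∧ RedUnitIso F O (alternatingGroup (Fin 4)) →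
        ∃ e : H ≃ₐ[F] ℍ[F, -1, -1], O = M.comap (e : H →+* ℍ[F, -1, -1]) := by
      intro O hO
      obtain ⟨e, he⟩ := hrec O hO
      have hO' := hO.1.comap e.symm
      have hOe := comap_comap_symm O e.symm
      rcases hmax _ hO'.1 he with h | h
      · refine ⟨e, hOe.symm.trans ?_⟩
        rw [← hO'.2 _ hM.1 h]
        rfl
      · refine ⟨e.trans (twist F), hOe.symm.trans ?_⟩
        rw [← hO'.2 _ (hM.comap (twist F)).1 h]
        rfl
    refine Nat.card_eq_one_iff_unique.2 ⟨⟨?_⟩, ⟨Quot.mk _ ⟨_, hM.comap e₀, hMA.comap e₀⟩⟩⟩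
    rintro ⟨O, hO⟩ ⟨O', hO'⟩
    apply Quot.sound
    obtain ⟨e, rfl⟩ := hall O hO
    obtain ⟨e', rfl⟩ := hall O' hO'
    exact conjRel_comap σ₀ M e e'
  · have : IsEmpty {O : Subring H // IsMaximalOrder F O ∧
        RedUnitIso F O (alternatingGroup (Fin 4))} := by
      refine ⟨fun ⟨O, hO⟩ => ?_⟩
      obtain ⟨e, he⟩ := hrec O hO
      obtain ⟨t, ht⟩ := not_not.1 fun h' => h ⟨⟨e⟩, h'⟩
      exact not_redUnitIso_of_two_mul_eq_sq hdsf h2 hsqrtd hgen ht (hO.1.comap e.symm) he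
        (hO.2.comap e.symm)
    have : IsEmpty (Quot fun O O' : {O : Subring H // IsMaximalOrder F O ∧
        RedUnitIso F O (alternatingGroup (Fin 4))} => ConjRel O.1 O'.1) :=
      ⟨by rintro ⟨O⟩; exact this.false O⟩
    exact Nat.card_of_isEmpty

end QuatPaper
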